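/- Let G be a finite group and M a semi-Mackey functor over G. Then sT(M), with its restrictions, transfers and norms, is a semi-Tambara functor, and for every semi-Tambara functor R the assignment F ↦ F ∘ θ_M is a bijection from Hom_{sTamb(G)}(sT(M), R) to Hom_{sMack(G)}(M, R); that is, sT(M) together with θ_M : M → sT(M) is the free semi-Tambara functor on M. -/

import Mathlib

set_option autoImplicit false

namespace Tamb

variable {G : Type} [Group G]

/-- A function between `G`-sets is equivariant. -/
def IsEquivariant (G : Type) [Group G] {A B : Type} [SMul G A] [SMul G B] (f : A → B) : Prop :=
  ∀ (g : G) (a : A), f (g • a) = g • f a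

section Maps

variable {X Y Z : Type} [MulAction G X] [MulAction G Y] [MulAction G Z]

/-- The identity equivariant map. -/
def gid (G X : Type) [Group G] [MulAction G X] : X →[G] X :=
  ⟨fun x => x, fun _ _ => rfl⟩

@[simp] theorem gid_apply (x : X) : gid G X x = x := rfl

/-- Composition of equivariant maps. -/
def gcomp (j : Y →[G] Z) (i : X →[G] Y) : X →[G] Z :=
  ⟨fun x => j (i x), fun g x => by
    show j (i (g • x)) = g • j (i x)
    rw [MulActionHom.map_smul, MulActionHom.map_smul]⟩

@[simp] theorem gcomp_apply (j : Y →[G] Z) (i : X →[G] Y) (x : X) : gcomp j i x = j (i x) := rfl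

/-- The pullback of two equivariant maps of `G`-sets. -/
def Pb (f : X →[G] Z) (g : Y →[G] Z) : Type := {p : X × Y // f p.1 = g p.2}

namespace Pb

variable (f : X →[G] Z) (g : Y →[G] Z)

instance : SMul G (Pb f g) :=
  ⟨fun a p => ⟨(a • p.1.1, a • p.1.2), by
    rw [MulActionHom.map_smul, MulActionHom.map_smul, p.2]⟩⟩

instance : MulAction G (Pb f g) where
  one_smul p := Subtype.ext (Prod.ext (one_smul _ _) (one_smul _ _))
  mul_smul a b p := Subtype.ext (Prod.ext (mul_smul _ _ _) (mul_smul _ _ _))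

instance [Finite X] [Finite Y] : Finite (Pb f g) := Subtype.finite

/-- First projection of a pullback. -/
def fstHom : Pb f g →[G] X := ⟨fun p => p.1.1, fun _ _ => rfl⟩
/-- Second projection of a pullback. -/
def sndHom : Pb f g →[G] Y := ⟨fun p => p.1.2, fun _ _ => rfl⟩

@[simp] theorem fstHom_apply (p : Pb f g) : fstHom f g p = p.1.1 := rfl
@[simp] theorem sndHom_apply (p : Pb f g) : sndHom f g p = p.1.2 := rfl

end Pb

/-- `Sec i j` is the set `∏_{i,j} X` of sections of `i : X → Y` defined on fibers
of `j : Y → Z`: an element is a point `z : Z` together with a section of `i`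
defined on `j⁻¹(z)`. -/
structure Sec (i : X →[G] Y) (j : Y →[G] Z) where
  pt : Z
  sec : ∀ y : Y, j y = pt → X
  isSec : ∀ (y : Y) (h : j y = pt), i (sec y h) = y

namespace Sec

variable {i : X →[G] Y} {j : Y →[G] Z}

theorem ext' {σ τ : Sec i j} (h1 : σ.pt = τ.pt)
    (h2 : ∀ (y : Y) (h : j y = σ.pt) (h' : j y = τ.pt), σ.sec y h = τ.sec y h') : σ = τ := by
  obtain ⟨p, s, hs⟩ := σ
  obtain ⟨p', s', hs'⟩ := τ
  dsimp at h1
  subst h1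
  have hss : s = s' := by
    funext y hy
    exact h2 y hy hy
  subst hss
  rfl

theorem sec_congr (σ : Sec i j) {y y' : Y} (e : y = y') {h : j y = σ.pt} {h' : j y' = σ.pt} :
    σ.sec y h = σ.sec y' h' := by subst e; rfl

instance : SMul G (Sec i j) :=
  ⟨fun a σ =>
    { pt := a • σ.pt
      sec := fun y h => a • σ.sec (a⁻¹ • y) (by rw [MulActionHom.map_smul, h, inv_smul_smul])
      isSec := fun y h => by
        rw [MulActionHom.map_smul, σ.isSec, smul_inv_smul] }⟩

@[simp] theorem smul_pt (a : G) (σ : Sec i j) : (a • σ).pt = a • σ.pt := rfl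

theorem smul_sec (a : G) (σ : Sec i j) (y : Y) (h : j y = (a • σ).pt)
    (h' : j (a⁻¹ • y) = σ.pt) : (a • σ).sec y h = a • σ.sec (a⁻¹ • y) h' := rfl

instance : MulAction G (Sec i j) where
  one_smul σ := by
    refine ext' (one_smul _ _) (fun y h h' => ?_)
    have h'' : j ((1 : G)⁻¹ • y) = σ.pt := by rw [inv_one, one_smul]; exact h'
    rw [smul_sec 1 σ y h h'', one_smul]
    exact sec_congr σ (by rw [inv_one, one_smul])
  mul_smul a b σ := by
    refine ext' (mul_smul _ _ _) (fun y h h' => ?_)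
    have h1 : j ((a * b)⁻¹ • y) = σ.pt := by
      rw [MulActionHom.map_smul, h]
      exact inv_smul_smul _ _
    have h2 : j (a⁻¹ • y) = (b • σ).pt := by
      rw [MulActionHom.map_smul, h']
      show a⁻¹ • (a • (b • σ).pt) = _
      exact inv_smul_smul _ _
    have h3 : j (b⁻¹ • (a⁻¹ • y)) = σ.pt := by
      rw [MulActionHom.map_smul, h2]
      exact inv_smul_smul _ _
    rw [smul_sec (a * b) σ y h h1, smul_sec a (b • σ) y h' h2, smul_sec b σ (a⁻¹ • y) h2 h3,
      mul_smul]
    exact congrArg (a • ·) (congrArg (b • ·) (sec_congr σ (by rw [mul_inv_rev, mul_smul])))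

instance optionFinite {X : Type} [Finite X] : Finite (Option X) :=
  Finite.of_equiv (X ⊕ PUnit.{1}) (Equiv.optionEquivSumPUnit.{0,0} X).symm

instance [Finite X] [Finite Y] [Finite Z] : Finite (Sec i j) := by
  classical
  have hF : Function.Injective (fun σ : Sec i j =>
      ((σ.pt, fun y => if h : j y = σ.pt then some (σ.sec y h) else none) :
        Z × (Y → Option X))) := by
    intro σ τ he
    have h1 : σ.pt = τ.pt := congrArg Prod.fst he
    refine ext' h1 (fun y hy hy' => ?_)
    have h2 := congrFun (congrArg Prod.snd he) y
    dsimp only at h2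
    rw [dif_pos hy, dif_pos hy'] at h2
    exact Option.some_injective _ h2
  exact Finite.of_injective _ hF

end Sec

/-- The canonical projection `∏_{i,j} X → Z`. -/
def pHom (i : X →[G] Y) (j : Y →[G] Z) : Sec i j →[G] Z :=
  ⟨fun σ => σ.pt, fun _ _ => rfl⟩

@[simp] theorem pHom_apply (i : X →[G] Y) (j : Y →[G] Z) (σ : Sec i j) :
    pHom i j σ = σ.pt := rfl

/-- The canonical pullback `Y ×_Z ∏_{i,j} X`. -/
abbrev ECan (i : X →[G] Y) (j : Y →[G] Z) : Type := Pb j (pHom i j)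

/-- The evaluation map `e : Y ×_Z ∏_{i,j} X → X`. -/
def eval (i : X →[G] Y) (j : Y →[G] Z) : ECan i j → X := fun q => q.1.2.sec q.1.1 q.2

theorem eval_smul (i : X →[G] Y) (j : Y →[G] Z) (a : G) (q : ECan i j) :
    eval i j (a • q) = a • eval i j q := by
  have h1 : j (a • q.1.1) = (a • q.1.2).pt := by
    rw [MulActionHom.map_smul, q.2]; rfl
  have h2 : j (a⁻¹ • (a • q.1.1)) = q.1.2.pt := by rw [inv_smul_smul]; exact q.2
  calc eval i j (a • q) = (a • q.1.2).sec (a • q.1.1) h1 := rfl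
    _ = a • q.1.2.sec (a⁻¹ • (a • q.1.1)) h2 := Sec.smul_sec _ _ _ _ _
    _ = a • q.1.2.sec q.1.1 q.2 := congrArg (a • ·) (Sec.sec_congr _ (inv_smul_smul a q.1.1))

/-- The evaluation map as an equivariant map. -/
def evalHom (i : X →[G] Y) (j : Y →[G] Z) : ECan i j →[G] X :=
  ⟨eval i j, eval_smul i j⟩

/-- The projection `π₂ : Y ×_Z ∏_{i,j} X → ∏_{i,j} X` of the canonical exponential diagram. -/
def pi2Hom (i : X →[G] Y) (j : Y →[G] Z) : ECan i j →[G] Sec i j :=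
  Pb.sndHom j (pHom i j)

end Maps

/-- `(f, g, h)` is a distributor for `(i, j)`: the diagram with bottom row
`X →i Y →j Z`, top row `g : A → B`, left vertical `f : A → X` and right vertical
`h : B → Z` is an exponential diagram, i.e. it is isomorphic (by equivariant
bijections fixing the bottom row) to the canonical diagram built from `∏_{i,j} X`. -/
def IsDistributor {X Y Z A B : Type} [MulAction G X] [MulAction G Y] [MulAction G Z]
    [MulAction G A] [MulAction G B]
    (i : X →[G] Y) (j : Y →[G] Z) (f : A →[G] X) (g : A →[G] B) (h : B →[G] Z) : Prop :=
  ∃ (α : A ≃ ECan i j) (β : B ≃ Sec i j),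
    IsEquivariant G ⇑α ∧ IsEquivariant G ⇑β ∧
    (∀ a, eval i j (α a) = f a) ∧
    (∀ a, β (g a) = (α a).1.2) ∧
    (∀ b, (β b).pt = h b)
section CoreB

/-- A (bundled) finite `G`-set. -/
structure FinGSet (G : Type) [Group G] : Type 1 where
  carrier : Type
  [fin : Finite carrier]
  [act : MulAction G carrier]

attribute [instance] FinGSet.fin FinGSet.act

instance : MulAction G Empty where
  smul _ e := e.elim
  one_smul e := e.elim
  mul_smul _ _ e := e.elim

/-- Bundle a finite `G`-set. -/
def mkG (G : Type) [Group G] (A : Type) [MulAction G A] [Finite A] : FinGSet G := ⟨A⟩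

/-- The empty `G`-set. -/
def emptyG (G : Type) [Group G] : FinGSet G := ⟨Empty⟩
/-- The one-point `G`-set (`G/G`). -/
def ptG (G : Type) [Group G] : FinGSet G := ⟨PUnit⟩
/-- Binary coproduct of finite `G`-sets. -/
def sumG (X Y : FinGSet G) : FinGSet G := ⟨X.carrier ⊕ Y.carrier⟩
/-- Binary product of finite `G`-sets. -/
def prodG (X Y : FinGSet G) : FinGSet G := ⟨X.carrier × Y.carrier⟩

def initHom (X : FinGSet G) : (emptyG G).carrier →[G] X.carrier :=
  ⟨fun e => e.elim, fun _ e => e.elim⟩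
def toPtHom (X : FinGSet G) : X.carrier →[G] (ptG G).carrier :=
  ⟨fun _ => PUnit.unit, fun _ _ => rfl⟩
def inlHom (X Y : FinGSet G) : X.carrier →[G] (sumG X Y).carrier :=
  ⟨Sum.inl, fun _ _ => rfl⟩
def inrHom (X Y : FinGSet G) : Y.carrier →[G] (sumG X Y).carrier :=
  ⟨Sum.inr, fun _ _ => rfl⟩
def sumMapHom {X Y X' Y' : FinGSet G} (f : X.carrier →[G] X'.carrier)
    (g : Y.carrier →[G] Y'.carrier) : (sumG X Y).carrier →[G] (sumG X' Y').carrier :=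
  ⟨Sum.map f g, fun a x => by
    cases x with
    | inl v => show Sum.inl (f (a • v)) = Sum.inl (a • f v); rw [MulActionHom.map_smul]
    | inr v => show Sum.inr (g (a • v)) = Sum.inr (a • g v); rw [MulActionHom.map_smul]⟩
def sumElimHom {X Y Z : FinGSet G} (f : X.carrier →[G] Z.carrier)
    (g : Y.carrier →[G] Z.carrier) : (sumG X Y).carrier →[G] Z.carrier :=
  ⟨Sum.elim f g, fun a x => by
    cases x with
    | inl v => show f (a • v) = a • f v; rw [MulActionHom.map_smul]
    | inr v => show g (a • v) = a • g v; rw [MulActionHom.map_smul]⟩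
/-- The fold map `X ⊔ X → X`. -/
def foldHom (X : FinGSet G) : (sumG X X).carrier →[G] X.carrier :=
  sumElimHom (gid G X.carrier) (gid G X.carrier)
def prodMapHom {X Y X' Y' : FinGSet G} (f : X.carrier →[G] X'.carrier)
    (g : Y.carrier →[G] Y'.carrier) : (prodG X Y).carrier →[G] (prodG X' Y').carrier :=
  ⟨Prod.map f g, fun a x => Prod.ext (MulActionHom.map_smul f a x.1) (MulActionHom.map_smul g a x.2)⟩
def pi1Hom (X Y : FinGSet G) : (prodG X Y).carrier →[G] X.carrier :=
  ⟨Prod.fst, fun _ _ => rfl⟩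
def pi2ProdHom (X Y : FinGSet G) : (prodG X Y).carrier →[G] Y.carrier :=
  ⟨Prod.snd, fun _ _ => rfl⟩

/-- A semi-Mackey functor over `G` (with set values): restrictions and transfers,
functorial, converting coproducts into products, and satisfying the pullback
(Mackey double coset) condition. -/
structure SemiMackey (G : Type) [Group G] : Type 2 where
  obj : FinGSet G → Type 1
  nonempty : ∀ X, Nonempty (obj X)
  res : ∀ {X Y : FinGSet G}, (X.carrier →[G] Y.carrier) → obj Y → obj X
  tr : ∀ {X Y : FinGSet G}, (X.carrier →[G] Y.carrier) → obj X → obj Y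
  res_id : ∀ {X : FinGSet G} (x : obj X), res (gid G X.carrier) x = x
  res_comp : ∀ {X Y Z : FinGSet G} (i : X.carrier →[G] Y.carrier)
    (j : Y.carrier →[G] Z.carrier) (z : obj Z), res i (res j z) = res (gcomp j i) z
  tr_id : ∀ {X : FinGSet G} (x : obj X), tr (gid G X.carrier) x = x
  tr_comp : ∀ {X Y Z : FinGSet G} (i : X.carrier →[G] Y.carrier)
    (j : Y.carrier →[G] Z.carrier) (x : obj X), tr j (tr i x) = tr (gcomp j i) x
  mackey : ∀ {X Y Z : FinGSet G} (j : X.carrier →[G] Z.carrier)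
    (i : Y.carrier →[G] Z.carrier) (y : obj Y),
    res j (tr i y) =
      tr (X := mkG G (Pb j i)) (Pb.fstHom j i) (res (X := mkG G (Pb j i)) (Pb.sndHom j i) y)
  sum_bij : ∀ (X Y : FinGSet G),
    Function.Bijective (fun z : obj (sumG X Y) => (res (inlHom X Y) z, res (inrHom X Y) z))
  empty_subsingleton : Subsingleton (obj (emptyG G))

/-- A semi-Tambara functor over `G`: a semi-Mackey functor with multiplicative
norms, commuting with restrictions over pullbacks and satisfying the
distributive law over exponential diagrams. -/
structure SemiTambara (G : Type) [Group G] extends SemiMackey G : Type 2 where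
  nm : ∀ {X Y : FinGSet G}, (X.carrier →[G] Y.carrier) → obj X → obj Y
  nm_id : ∀ {X : FinGSet G} (x : obj X), nm (gid G X.carrier) x = x
  nm_comp : ∀ {X Y Z : FinGSet G} (i : X.carrier →[G] Y.carrier)
    (j : Y.carrier →[G] Z.carrier) (x : obj X), nm j (nm i x) = nm (gcomp j i) x
  nm_res : ∀ {X Y Z : FinGSet G} (j : X.carrier →[G] Z.carrier)
    (i : Y.carrier →[G] Z.carrier) (y : obj Y),
    res j (nm i y) =
      nm (X := mkG G (Pb j i)) (Pb.fstHom j i) (res (X := mkG G (Pb j i)) (Pb.sndHom j i) y)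
  distrib : ∀ {X Y Z A B : FinGSet G} (i : X.carrier →[G] Y.carrier)
    (j : Y.carrier →[G] Z.carrier) (f : A.carrier →[G] X.carrier)
    (g : A.carrier →[G] B.carrier) (h : B.carrier →[G] Z.carrier),
    IsDistributor i j f g h → ∀ x : obj X, nm j (tr i x) = tr h (nm g (res f x))

/-- The element of `M(X ⊔ Y)` corresponding to a pair `(x, y)`. -/
noncomputable def SemiMackey.pairElt (M : SemiMackey G) {X Y : FinGSet G}
    (x : M.obj X) (y : M.obj Y) : M.obj (sumG X Y) :=
  (Equiv.ofBijective _ (M.sum_bij X Y)).symm (x, y)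

/-- The addition on `M(X)` induced by transfer along the fold map. -/
noncomputable def SemiMackey.add (M : SemiMackey G) {X : FinGSet G} (x y : M.obj X) : M.obj X :=
  M.tr (foldHom X) (M.pairElt x y)

/-- The zero of `M(X)`: the transfer of the unique element of `M(∅)`. -/
noncomputable def SemiMackey.zero (M : SemiMackey G) (X : FinGSet G) : M.obj X :=
  M.tr (initHom X) (M.nonempty (emptyG G)).some

/-- The multiplication on `R(X)` induced by the norm along the fold map. -/
noncomputable def SemiTambara.mul (R : SemiTambara G) {X : FinGSet G} (x y : R.obj X) :
    R.obj X :=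
  R.nm (foldHom X) (R.toSemiMackey.pairElt x y)

/-- The multiplicative unit of `R(X)`: the norm of the unique element of `R(∅)`. -/
noncomputable def SemiTambara.one (R : SemiTambara G) (X : FinGSet G) : R.obj X :=
  R.nm (initHom X) (R.nonempty (emptyG G)).some

/-- A Mackey functor: a semi-Mackey functor all of whose values are abelian
groups under the transfer-induced addition. -/
structure Mackey (G : Type) [Group G] extends SemiMackey G : Type 2 where
  hasNeg : ∀ (X : FinGSet G) (x : obj X), ∃ y, toSemiMackey.add x y = toSemiMackey.zero X

/-- A Tambara functor: a semi-Tambara functor all of whose values are abelian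
groups under the transfer-induced addition. -/
structure Tambara (G : Type) [Group G] extends SemiTambara G : Type 2 where
  hasNeg : ∀ (X : FinGSet G) (x : obj X),
    ∃ y, toSemiMackey.add x y = toSemiMackey.zero X

/-- A map of semi-Mackey functors. -/
structure SMackHom {G : Type} [Group G] (M N : SemiMackey G) : Type 1 where
  app : ∀ X, M.obj X → N.obj X
  app_res : ∀ {X Y : FinGSet G} (f : X.carrier →[G] Y.carrier) (y : M.obj Y),
    app X (M.res f y) = N.res f (app Y y)
  app_tr : ∀ {X Y : FinGSet G} (f : X.carrier →[G] Y.carrier) (x : M.obj X),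
    app Y (M.tr f x) = N.tr f (app X x)

/-- A map of semi-Tambara functors. -/
structure STambHom {G : Type} [Group G] (M N : SemiTambara G) extends
    SMackHom M.toSemiMackey N.toSemiMackey : Type 1 where
  app_nm : ∀ {X Y : FinGSet G} (f : X.carrier →[G] Y.carrier) (x : M.obj X),
    app Y (M.nm f x) = N.nm f (app X x)

/-- A formal "transfer of a norm of an element of `M`": a pair
`(U →i V →j X, u ∈ M(U))`. -/
structure PreT {G : Type} [Group G] (M : SemiMackey G) (X : FinGSet G) : Type 1 where
  U : FinGSet G
  V : FinGSet G
  i : U.carrier →[G] V.carrier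
  j : V.carrier →[G] X.carrier
  u : M.obj U

/-- Two pairs are isomorphic. -/
def IsoRel (M : SemiMackey G) (X : FinGSet G) (a b : PreT M X) : Prop :=
  ∃ (f : b.U.carrier ≃ a.U.carrier) (g : b.V.carrier ≃ a.V.carrier)
    (hf : IsEquivariant G ⇑f) (_ : IsEquivariant G ⇑g),
    (∀ u' : b.U.carrier, a.i (f u') = g (b.i u')) ∧
    (∀ v' : b.V.carrier, a.j (g v') = b.j v') ∧
    M.res (MulActionHom.mk ⇑f hf) a.u = b.u

/-- The relation defining the free semi-Tambara functor `sT(M)`: pairs are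
identified up to isomorphism and the distributive-law relation. -/
inductive STRel (M : SemiMackey G) (X : FinGSet G) : PreT M X → PreT M X → Prop
  | iso {a b : PreT M X} : IsoRel M X a b → STRel M X a b
  | distrib {W U V A B : FinGSet G} (k : W.carrier →[G] U.carrier)
      (i : U.carrier →[G] V.carrier) (j : V.carrier →[G] X.carrier)
      (f : A.carrier →[G] W.carrier) (g : A.carrier →[G] B.carrier)
      (h : B.carrier →[G] V.carrier) :
      IsDistributor k i f g h → ∀ w : M.obj W,
      STRel M X ⟨U, V, i, j, M.tr k w⟩ ⟨A, B, g, gcomp j h, M.res f w⟩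

/-- The value of the free semi-Tambara functor on `M` at `X`. -/
def sT (M : SemiMackey G) (X : FinGSet G) : Type 1 := Quot (STRel M X)

/-- The universal map `θ_M : M → sT(M)`, at the level of representatives. -/
def thetaPre (M : SemiMackey G) (X : FinGSet G) (x : M.obj X) : PreT M X :=
  ⟨X, X, gid G X.carrier, gid G X.carrier, x⟩

/-- Transfer on representatives: postcomposition. -/
def trPre (M : SemiMackey G) {X Y : FinGSet G} (f : X.carrier →[G] Y.carrier)
    (a : PreT M X) : PreT M Y :=
  ⟨a.U, a.V, a.i, gcomp f a.j, a.u⟩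

/-- Restriction on representatives: pull back both maps. -/
def resPre (M : SemiMackey G) {X Y : FinGSet G} (f : Y.carrier →[G] X.carrier)
    (a : PreT M X) : PreT M Y where
  U := mkG G (Pb a.i (Pb.fstHom a.j f))
  V := mkG G (Pb a.j f)
  i := Pb.sndHom a.i (Pb.fstHom a.j f)
  j := Pb.sndHom a.j f
  u := M.res (X := mkG G (Pb a.i (Pb.fstHom a.j f))) (Pb.fstHom a.i (Pb.fstHom a.j f)) a.u

/-- Norm on representatives, via the canonical exponential diagram for `(j, f)`. -/
def normPre (M : SemiMackey G) {X Y : FinGSet G} (f : X.carrier →[G] Y.carrier)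
    (a : PreT M X) : PreT M Y where
  U := mkG G (Pb a.i (evalHom a.j f))
  V := mkG G (Sec a.j f)
  i := gcomp (pi2Hom a.j f) (Pb.sndHom a.i (evalHom a.j f))
  j := pHom a.j f
  u := M.res (X := mkG G (Pb a.i (evalHom a.j f))) (Pb.fstHom a.i (evalHom a.j f)) a.u

/-- Addition on representatives: disjoint union. -/
noncomputable def addPre (M : SemiMackey G) {X : FinGSet G} (a b : PreT M X) : PreT M X where
  U := sumG a.U b.U
  V := sumG a.V b.V
  i := sumMapHom a.i b.i
  j := sumElimHom a.j b.j
  u := M.pairElt a.u b.u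

/-- A pair has (pure) degree `n` if every fiber of its first map has exactly `n`
elements. -/
def DegN {M : SemiMackey G} {X : FinGSet G} (n : ℕ) (a : PreT M X) : Prop :=
  ∀ v : a.V.carrier, Nat.card {u : a.U.carrier // a.i u = v} = n

/-- A finite `G`-set over `X` (a representative for the Burnside semi-Mackey functor). -/
structure BurnPre (G : Type) [Group G] (X : FinGSet G) : Type 1 where
  A : FinGSet G
  f : A.carrier →[G] X.carrier

/-- Isomorphism of finite `G`-sets over `X`. -/
def BurnIso {X : FinGSet G} (s t : BurnPre G X) : Prop :=
  ∃ (e : s.A.carrier ≃ t.A.carrier) (_ : IsEquivariant G ⇑e), ∀ x, t.f (e x) = s.f x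

/-- The pair `(∅ → A →f X, 0)` associated to a `G`-set over `X`. -/
noncomputable def bPair (M : SemiMackey G) {X : FinGSet G} (s : BurnPre G X) : PreT M X :=
  ⟨emptyG G, s.A, initHom s.A, s.f, (M.nonempty (emptyG G)).some⟩

end CoreB

/-- A commutative square of sets that is a pullback, stated on elements. -/
structure PbSq {P X Y Z : Type} (p : P → X) (q : P → Y) (f : X → Z) (g : Y → Z) : Prop where
  comm : ∀ w, f (p w) = g (q w)
  ex : ∀ x y, f x = g y → ∃ w, p w = x ∧ q w = y
  inj : ∀ w w', p w = p w' → q w = q w' → w = w'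

namespace PbSq

variable {P P' X Y Z X' Y' Z' : Type}

theorem symm {p : P → X} {q : P → Y} {f : X → Z} {g : Y → Z} (h : PbSq p q f g) :
    PbSq q p g f :=
  ⟨fun w => (h.comm w).symm,
    fun y x e => let ⟨w, h1, h2⟩ := h.ex x y e.symm; ⟨w, h2, h1⟩,
    fun w w' h1 h2 => h.inj w w' h2 h1⟩

theorem idRight (f : X → Z) : PbSq (fun x => x) f f (fun z => z) :=
  ⟨fun _ => rfl, fun x _ e => ⟨x, rfl, e⟩, fun _ _ h _ => h⟩

/-- Horizontal pasting of pullback squares. -/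
theorem paste {p : P → X} {q : P → Y} {f : X → Z} {g : Y → Z} {p' : P' → P} {q' : P' → Y'}
    {g' : Y' → Y} (h : PbSq p q f g) (h' : PbSq p' q' q g') :
    PbSq (fun w => p (p' w)) q' f (fun y => g (g' y)) where
  comm w := by rw [h.comm, h'.comm]
  ex x y e := by
    obtain ⟨w, h1, h2⟩ := h.ex x (g' y) e
    obtain ⟨w', h3, h4⟩ := h'.ex w y h2
    exact ⟨w', by rw [h3, h1], h4⟩
  inj w w' h1 h2 :=
    h'.inj _ _ (h.inj _ _ h1 (by rw [h'.comm, h'.comm, h2])) h2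

/-- Cancellation of pullback squares. -/
theorem cancel {p : P → X} {q : P → Y} {f : X → Z} {g : Y → Z} {p' : P' → P} {q' : P' → Y'}
    {g' : Y' → Y} (h : PbSq p q f g) (h' : PbSq (fun w => p (p' w)) q' f (fun y => g (g' y)))
    (hc : ∀ w, q (p' w) = g' (q' w)) : PbSq p' q' q g' where
  comm := hc
  ex w y e := by
    obtain ⟨w', h1, h2⟩ := h'.ex (p w) y (by rw [h.comm, e])
    exact ⟨w', h.inj _ _ h1 (by rw [hc, h2, e]), h2⟩
  inj w w' h1 h2 := h'.inj _ _ (congrArg p h1) h2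

theorem compBij {p : P → X} {q : P → Y} {f : X → Z} {g : Y → Z} {g' : Y' → Z} {c : Y → Y'}
    (h : PbSq p q f g) (hc : Function.Bijective c) (e : ∀ y, g' (c y) = g y) :
    PbSq p (fun w => c (q w)) f g' where
  comm w := by rw [h.comm, e]
  ex x y hxy := by
    obtain ⟨y, rfl⟩ := hc.2 y
    obtain ⟨w, h1, h2⟩ := h.ex x y (by rw [hxy, e])
    exact ⟨w, h1, by rw [h2]⟩
  inj w w' h1 h2 := h.inj _ _ h1 (hc.1 h2)

theorem bijective {p : P → X} {q : P → Y} {p' : P' → X} {q' : P' → Y} {f : X → Z} {g : Y → Z}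
    (h : PbSq p q f g) (h' : PbSq p' q' f g) {c : P' → P} (hp : ∀ w, p (c w) = p' w)
    (hq : ∀ w, q (c w) = q' w) : Function.Bijective c := by
  constructor
  · intro w w' e
    exact h'.inj _ _ (by rw [← hp, ← hp, e]) (by rw [← hq, ← hq, e])
  · intro w
    obtain ⟨w', h1, h2⟩ := h'.ex (p w) (q w) (h.comm w)
    exact ⟨w', h.inj _ _ (by rw [hp, h1]) (by rw [hq, h2])⟩

theorem sumMap {P' X' Y' Z' : Type} {p : P → X} {q : P → Y} {f : X → Z} {g : Y → Z}
    {p' : P' → X'} {q' : P' → Y'} {f' : X' → Z'} {g' : Y' → Z'} (h : PbSq p q f g)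
    (h' : PbSq p' q' f' g') :
    PbSq (Sum.map p p') (Sum.map q q') (Sum.map f f') (Sum.map g g') where
  comm := by
    rintro (w | w)
    · exact congrArg Sum.inl (h.comm w)
    · exact congrArg Sum.inr (h'.comm w)
  ex := by
    rintro (x | x) (y | y) e
    · obtain ⟨w, rfl, rfl⟩ := h.ex x y (Sum.inl_injective e)
      exact ⟨Sum.inl w, rfl, rfl⟩
    · cases e
    · cases e
    · obtain ⟨w, rfl, rfl⟩ := h'.ex x y (Sum.inr_injective e)
      exact ⟨Sum.inr w, rfl, rfl⟩
  inj := by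
    rintro (w | w) (w' | w') h1 h2
    · exact congrArg Sum.inl (h.inj _ _ (Sum.inl_injective h1) (Sum.inl_injective h2))
    · cases h1
    · cases h1
    · exact congrArg Sum.inr (h'.inj _ _ (Sum.inr_injective h1) (Sum.inr_injective h2))

theorem inl (f : X → Z) (f' : X' → Z') : PbSq f Sum.inl Sum.inl (Sum.map f f') where
  comm _ := rfl
  ex := by
    rintro z (x | x) e
    · exact ⟨x, (Sum.inl_injective e).symm, rfl⟩
    · cases e
  inj _ _ _ h := Sum.inl_injective h

theorem inr (f : X → Z) (f' : X' → Z') : PbSq f' Sum.inr Sum.inr (Sum.map f f') where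
  comm _ := rfl
  ex := by
    rintro z (x | x) e
    · cases e
    · exact ⟨x, (Sum.inr_injective e).symm, rfl⟩
  inj _ _ _ h := Sum.inr_injective h

/-- The pullbacks of a map into a binary coproduct along the two inclusions cover its source. -/
theorem sumElim_bijective {P' X' : Type} {p : P → Z} {q : P → X} {p' : P' → Z} {q' : P' → X'}
    {f : Z → X ⊕ X'} (h : PbSq p q f Sum.inl) (h' : PbSq p' q' f Sum.inr) :
    Function.Bijective (Sum.elim p p') := by
  constructor
  · rintro (w | w) (w' | w') e
    · replace e : p w = p w' := e
      refine congrArg Sum.inl (h.inj _ _ e (Sum.inl_injective (β := X') ?_))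
      rw [← h.comm, ← h.comm, e]
    · replace e : p w = p' w' := e
      have := h.comm w
      rw [e, h'.comm] at this
      cases this
    · replace e : p' w = p w' := e
      have := h.comm w'
      rw [← e, h'.comm] at this
      cases this
    · replace e : p' w = p' w' := e
      refine congrArg Sum.inr (h'.inj _ _ e (Sum.inr_injective (α := X) ?_))
      rw [← h'.comm, ← h'.comm, e]
  · intro z
    rcases hz : f z with x | x
    · obtain ⟨w, h1, -⟩ := h.ex z x hz
      exact ⟨Sum.inl w, h1⟩
    · obtain ⟨w, h1, -⟩ := h'.ex z x hz
      exact ⟨Sum.inr w, h1⟩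

end PbSq

/-- `S` is the image of a section of `i` over the fiber of `j` at `z`. -/
structure IsSect {X Y Z : Type} (i : X → Y) (j : Y → Z) (z : Z) (S : Set X) : Prop where
  fib : ∀ x ∈ S, j (i x) = z
  ex : ∀ y, j y = z → ∃ x ∈ S, i x = y
  inj : ∀ x ∈ S, ∀ x' ∈ S, i x = i x' → x = x'

/-- Exponential diagrams of sets, stated on elements. -/
structure Dist {X Y Z A B : Type} (i : X → Y) (j : Y → Z) (f : A → X) (g : A → B) (h : B → Z) :
    Prop where
  pb : PbSq (fun a => i (f a)) g j h
  ex : ∀ z S, IsSect i j z S → ∃ b, h b = z ∧ ∀ a, g a = b → f a ∈ S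
  uniq : ∀ b b', h b = h b' →
    (∀ a a', g a = b → g a' = b' → i (f a) = i (f a') → f a = f a') → b = b'

namespace Dist

variable {X Y Z A B : Type}

theorem idLeft {A B : Type} {f : A → X} {i : X → Y} {g : A → B} {h : B → Y}
    (hf : Function.Bijective f) (hh : Function.Bijective h) (e : ∀ a, i (f a) = h (g a)) :
    Dist (fun x => x) i f g h where
  pb := ⟨e, fun x b hb => by
      obtain ⟨a, rfl⟩ := hf.2 x
      exact ⟨a, rfl, hh.1 (by rw [← hb, e])⟩, fun w w' h1 _ => hf.1 h1⟩
  ex z S hS := by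
    obtain ⟨b, rfl⟩ := hh.2 z
    refine ⟨b, rfl, fun a ha => ?_⟩
    obtain ⟨x, hx, e'⟩ := hS.ex (f a) (by rw [e, ha])
    exact e' ▸ hx
  uniq b b' hb _ := hh.1 hb

theorem idMid {i : X → Y} {c : A → X} (hc : Function.Bijective c) :
    Dist i (fun y => y) c c i where
  pb := ⟨fun _ => rfl, fun y x hb => by
      obtain ⟨a, rfl⟩ := hc.2 x
      exact ⟨a, hb.symm, rfl⟩, fun w w' _ h => hc.1 h⟩
  ex z S hS := by
    obtain ⟨x, hx, e'⟩ := hS.ex z rfl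
    exact ⟨x, e', fun a ha => ha ▸ hx⟩
  uniq b b' hb H := by
    obtain ⟨a, rfl⟩ := hc.2 b
    obtain ⟨a', rfl⟩ := hc.2 b'
    exact H a a' rfl rfl hb

/-- Exponential diagrams are stable under base change. -/
theorem baseChange {W U V W' U' V' A' B' : Type} {k : W → U} {i : U → V} {f : A → W} {g : A → B}
    {h : B → V} (D : Dist k i f g h) {k' : W' → U'} {i' : U' → V'} {w : W' → W} {u : U' → U}
    {v : V' → V} (hk : PbSq w k' k u) (hi : PbSq u i' i v) {a : A' → A} {b : B' → B}
    {f' : A' → W'} {g' : A' → B'} {h' : B' → V'} (hh : PbSq b h' h v) (hg : PbSq a g' g b)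
    (e1 : ∀ x, w (f' x) = f (a x)) (e2 : ∀ x, i' (k' (f' x)) = h' (g' x)) :
    Dist k' i' f' g' h' where
  pb := by
    refine hi.cancel ?_ e2
    have h1 := D.pb.paste hg
    rwa [show (fun x => k (f (a x))) = fun x => u (k' (f' x)) from
      funext fun x => by rw [← hk.comm, e1], show (fun x => h (b x)) = fun x => v (h' x) from
      funext hh.comm] at h1
  ex z S hS := by
    have hS' : IsSect k i (v z) (w '' S) := by
      refine ⟨?_, ?_, ?_⟩
      · rintro _ ⟨x, hx, rfl⟩
        rw [hk.comm, hi.comm, hS.fib x hx]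
      · intro y hy
        obtain ⟨y, rfl, h2⟩ := hi.ex y z hy
        obtain ⟨x, hx, rfl⟩ := hS.ex y h2
        exact ⟨w x, ⟨x, hx, rfl⟩, hk.comm x⟩
      · rintro _ ⟨x, hx, rfl⟩ _ ⟨x', hx', rfl⟩ e
        rw [hk.comm, hk.comm] at e
        rw [hS.inj x hx x' hx' (hi.inj _ _ e (by rw [hS.fib x hx, hS.fib x' hx']))]
    obtain ⟨b0, hb0, H⟩ := D.ex _ _ hS'
    obtain ⟨b', rfl, rfl⟩ := hh.ex b0 z hb0
    refine ⟨b', rfl, ?_⟩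
    rintro a' ha'
    obtain ⟨s, hs, e⟩ := H (a a') (by rw [hg.comm, ha'])
    rw [← e1] at e
    refine hk.inj _ _ e (hi.inj _ _ ?_ ?_) ▸ hs
    · rw [← hk.comm, ← hk.comm, e]
    · rw [hS.fib s hs, e2, ha']
  uniq b1 b2 hb H := by
    refine hh.inj _ _ (D.uniq _ _ (by rw [hh.comm, hh.comm, hb]) ?_) hb
    intro a1 a2 h1 h2 h3
    obtain ⟨a1, rfl, rfl⟩ := hg.ex a1 b1 h1
    obtain ⟨a2, rfl, rfl⟩ := hg.ex a2 b2 h2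
    rw [← e1, ← e1]
    refine congrArg w (H a1 a2 rfl rfl (hi.inj _ _ ?_ ?_))
    · rw [← hk.comm, ← hk.comm, e1, e1, h3]
    · rw [e2, e2, hb]

/-- The exponential diagram of a composite in the first variable. -/
theorem compLeft {X' X'' A' B' : Type} {i : X → Y} {j : Y → Z} {f : A → X} {g : A → B}
    {h : B → Z} (D : Dist i j f g h) {i' : X' → X} {x' : X'' → X'} {i'' : X'' → A}
    (P : PbSq x' i'' i' f) {f' : A' → X''} {g' : A' → B'} {h' : B' → B}
    (D' : Dist i'' g f' g' h') :
    Dist (fun x => i (i' x)) j (fun a => x' (f' a)) g' (fun b => h (h' b)) where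
  pb := by
    have h1 := D.pb.paste D'.pb
    rwa [show (fun a => i (f (i'' (f' a)))) = fun a => i (i' (x' (f' a))) from
      funext fun a => by rw [P.comm]] at h1
  ex z S hS := by
    have hS1 : IsSect i j z (i' '' S) := by
      refine ⟨?_, ?_, ?_⟩
      · rintro _ ⟨x, hx, rfl⟩
        exact hS.fib x hx
      · intro y hy
        obtain ⟨x, hx, rfl⟩ := hS.ex y hy
        exact ⟨_, ⟨x, hx, rfl⟩, rfl⟩
      · rintro _ ⟨x, hx, rfl⟩ _ ⟨x', hx', rfl⟩ e
        rw [hS.inj x hx x' hx' e]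
    obtain ⟨b, rfl, H⟩ := D.ex _ _ hS1
    have hS2 : IsSect i'' g b {x | g (i'' x) = b ∧ x' x ∈ S} := by
      refine ⟨fun x hx => hx.1, ?_, ?_⟩
      · intro a ha
        obtain ⟨s, hs, e⟩ := H a ha
        obtain ⟨x, rfl, rfl⟩ := P.ex s a e
        exact ⟨x, ⟨ha, hs⟩, rfl⟩
      · intro x hx y hy e
        refine P.inj _ _ (hS.inj _ hx.2 _ hy.2 ?_) e
        rw [P.comm, P.comm, e]
    obtain ⟨b', rfl, H'⟩ := D'.ex _ _ hS2
    exact ⟨b', rfl, fun a ha => (H' a ha).2⟩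
  uniq b b' hb H := by
    have e1 : h' b = h' b' := by
      refine D.uniq _ _ hb fun a a' ha ha' e => ?_
      obtain ⟨t, rfl, rfl⟩ := D'.pb.ex a b ha
      obtain ⟨t', rfl, rfl⟩ := D'.pb.ex a' b' ha'
      rw [← P.comm, ← P.comm] at e ⊢
      rw [H t t' rfl rfl e]
    refine D'.uniq _ _ e1 fun a a' ha ha' e => P.inj _ _ (H a a' ha ha' ?_) e
    rw [P.comm, P.comm, e]

/-- The exponential diagram of a composite in the second variable. -/
theorem compRight {Z' A' B' R : Type} {i : X → Y} {j : Y → Z} {f : A → X} {g : A → B}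
    {h : B → Z} (D : Dist i j f g h) {j' : Z → Z'} {f' : A' → B} {g' : A' → B'} {h' : B' → Z'}
    (D' : Dist h j' f' g' h') {r : R → A} {q : R → A'} (P : PbSq r q g f') :
    Dist i (fun y => j' (j y)) (fun x => f (r x)) (fun x => g' (q x)) h' where
  pb := (D'.pb.symm.paste (D.pb.paste P).symm).symm
  ex z S hS := by
    have hSy : ∀ y, j' y = z → IsSect i j y {x | x ∈ S ∧ j (i x) = y} := by
      intro y hy
      refine ⟨fun x hx => hx.2, ?_, fun x hx x' hx' e => hS.inj x hx.1 x' hx'.1 e⟩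
      rintro t rfl
      obtain ⟨x, hx, rfl⟩ := hS.ex t hy
      exact ⟨x, ⟨hx, rfl⟩, rfl⟩
    have hT : IsSect h j' z {b | j' (h b) = z ∧ ∀ a, g a = b → f a ∈ S} := by
      refine ⟨fun b hb => hb.1, ?_, ?_⟩
      · intro y hy
        obtain ⟨b, rfl, H⟩ := D.ex y _ (hSy y hy)
        exact ⟨b, ⟨hy, fun a ha => (H a ha).1⟩, rfl⟩
      · intro b hb b' hb' e
        exact D.uniq _ _ e fun a a' ha ha' e' => hS.inj _ (hb.2 a ha) _ (hb'.2 a' ha') e'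
    obtain ⟨b', rfl, H⟩ := D'.ex _ _ hT
    exact ⟨b', rfl, fun a ha => (H _ ha).2 _ (P.comm a)⟩
  uniq b b' hb H := by
    refine D'.uniq _ _ hb fun a a' ha ha' e => D.uniq _ _ e fun t t' ht ht' e' => ?_
    obtain ⟨x, rfl, rfl⟩ := P.ex t a ht
    obtain ⟨x', rfl, rfl⟩ := P.ex t' a' ht'
    exact H x x' ha ha' e'

theorem sumMap {X' Y' Z' A' B' : Type} {i : X → Y} {j : Y → Z} {f : A → X} {g : A → B}
    {h : B → Z} (D : Dist i j f g h) {i' : X' → Y'} {j' : Y' → Z'} {f' : A' → X'} {g' : A' → B'}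
    {h' : B' → Z'} (D' : Dist i' j' f' g' h') :
    Dist (Sum.map i i') (Sum.map j j') (Sum.map f f') (Sum.map g g') (Sum.map h h') where
  pb := by
    have h1 := D.pb.sumMap D'.pb
    rwa [show Sum.map (fun a => i (f a)) (fun a => i' (f' a)) =
      fun a => Sum.map i i' (Sum.map f f' a) from funext fun a => by cases a <;> rfl] at h1
  ex z S hS := by
    rcases z with z | z
    · have h1 : IsSect i j z (Sum.inl ⁻¹' S) := by
        refine ⟨fun x hx => Sum.inl_injective (hS.fib _ hx), ?_, fun x hx x' hx' e =>
          Sum.inl_injective (hS.inj _ hx _ hx' (congrArg Sum.inl e))⟩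
        intro y hy
        obtain ⟨x | x, hx, e⟩ := hS.ex (Sum.inl y) (congrArg Sum.inl hy)
        · exact ⟨x, hx, Sum.inl_injective e⟩
        · cases e
      obtain ⟨b, rfl, H⟩ := D.ex _ _ h1
      refine ⟨Sum.inl b, rfl, ?_⟩
      rintro (a | a) ha
      · exact H a (Sum.inl_injective ha)
      · cases ha
    · have h1 : IsSect i' j' z (Sum.inr ⁻¹' S) := by
        refine ⟨fun x hx => Sum.inr_injective (hS.fib _ hx), ?_, fun x hx x' hx' e =>
          Sum.inr_injective (hS.inj _ hx _ hx' (congrArg Sum.inr e))⟩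
        intro y hy
        obtain ⟨x | x, hx, e⟩ := hS.ex (Sum.inr y) (congrArg Sum.inr hy)
        · cases e
        · exact ⟨x, hx, Sum.inr_injective e⟩
      obtain ⟨b, rfl, H⟩ := D'.ex _ _ h1
      refine ⟨Sum.inr b, rfl, ?_⟩
      rintro (a | a) ha
      · cases ha
      · exact H a (Sum.inr_injective ha)
  uniq := by
    rintro (b | b) (b' | b') hb H
    · refine congrArg Sum.inl (D.uniq _ _ (Sum.inl_injective hb) fun a a' ha ha' e => ?_)
      exact Sum.inl_injective (H (Sum.inl a) (Sum.inl a') (congrArg Sum.inl ha)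
        (congrArg Sum.inl ha') (congrArg Sum.inl e))
    · cases hb
    · cases hb
    · refine congrArg Sum.inr (D'.uniq _ _ (Sum.inr_injective hb) fun a a' ha ha' e => ?_)
      exact Sum.inr_injective (H (Sum.inr a) (Sum.inr a') (congrArg Sum.inr ha)
        (congrArg Sum.inr ha') (congrArg Sum.inr e))

end Dist

section Equivariant

variable {X Y Z A B P : Type} [MulAction G X] [MulAction G Y] [MulAction G Z] [MulAction G A]
  [MulAction G B] [MulAction G P]

theorem IsDistributor.dist {i : X →[G] Y} {j : Y →[G] Z} {f : A →[G] X} {g : A →[G] B}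
    {h : B →[G] Z} (D : IsDistributor i j f g h) : Dist i j f g h := by
  obtain ⟨α, β, -, -, hf, hg, hh⟩ := D
  have hy : ∀ a, i (f a) = (α a).1.1 := fun a => by
    rw [← hf]
    exact (α a).1.2.isSec _ _
  have key : ∀ y b, j y = h b → ∃ a, i (f a) = y ∧ g a = b ∧
      ∀ hb : j y = (β b).pt, f a = (β b).sec y hb := by
    intro y b e
    obtain ⟨a, ha⟩ := α.surjective ⟨(y, β b), e.trans (hh b).symm⟩
    refine ⟨a, ?_, ?_, ?_⟩
    · rw [hy, ha]
    · apply β.injective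
      rw [hg, ha]
    · intro hb
      rw [← hf, ha]
      rfl
  refine ⟨⟨fun a => ?_, ?_, ?_⟩, ?_, ?_⟩
  · rw [hy, ← hh, hg]
    exact (α a).2
  · intro y b e
    obtain ⟨a, h1, h2, -⟩ := key y b e
    exact ⟨a, h1, h2⟩
  · intro a a' h1 h2
    apply α.injective
    refine Subtype.ext (Prod.ext ?_ ?_)
    · rw [← hy, ← hy, h1]
    · rw [← hg, ← hg, h2]
  · intro z S hS
    choose s hs hi using hS.ex
    refine ⟨β.symm ⟨z, s, hi⟩, ?_, fun a ha => ?_⟩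
    · rw [← hh, Equiv.apply_symm_apply]
    · have h1 : (α a).1.2 = ⟨z, s, hi⟩ := by rw [← hg, ha, Equiv.apply_symm_apply]
      have h2 : ∀ (σ : Sec i j) (y : Y) (hy : j y = σ.pt), σ = ⟨z, s, hi⟩ → σ.sec y hy ∈ S := by
        rintro σ y hy rfl
        exact hs y hy
      rw [← hf]
      exact h2 _ _ _ h1
  · intro b b' e H
    apply β.injective
    refine Sec.ext' (by rw [hh, hh, e]) fun y h1 h2 => ?_
    obtain ⟨a, ha1, ha2, ha3⟩ := key y b (h1.trans (hh b))
    obtain ⟨a', ha1', ha2', ha3'⟩ := key y b' (h2.trans (hh b'))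
    rw [← ha3, ← ha3']
    exact H a a' ha2 ha2' (ha1.trans ha1'.symm)

theorem Dist.isDistributor {i : X →[G] Y} {j : Y →[G] Z} {f : A →[G] X} {g : A →[G] B}
    {h : B →[G] Z} (D : Dist i j f g h) : IsDistributor i j f g h := by
  choose t ht1 ht2 using D.pb.ex
  let β : B → Sec i j := fun b => ⟨h b, fun y e => f (t y b e), fun y e => ht1 y b e⟩
  let α : A → ECan i j := fun a => ⟨(i (f a), β (g a)), D.pb.comm a⟩
  have hsec : ∀ a (e : j (i (f a)) = h (g a)), f (t (i (f a)) (g a) e) = f a := fun a e =>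
    congrArg f (D.pb.inj _ _ (ht1 _ _ e) (ht2 _ _ e))
  have hβ : Function.Bijective β := by
    constructor
    · intro b b' e
      have e1 : h b = h b' := congrArg Sec.pt e
      have H : ∀ (σ τ : Sec i j) (y : Y) (h1 : j y = σ.pt) (h2 : j y = τ.pt), σ = τ →
          σ.sec y h1 = τ.sec y h2 := by
        rintro σ _ y h1 h2 rfl
        rfl
      refine D.uniq _ _ e1 ?_
      rintro a a' rfl rfl e2
      have h2 := H _ _ (i (f a)) (D.pb.comm a) ((D.pb.comm a).trans e1) e
      refine (hsec a _).symm.trans (h2.trans ?_)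
      refine congrArg f (D.pb.inj _ _ ((ht1 _ _ _).trans e2) (ht2 _ _ _))
    · rintro ⟨z, s, hs⟩
      have hS : IsSect i j z {x | ∃ (y : Y) (e : j y = z), x = s y e} := by
        refine ⟨?_, ?_, ?_⟩
        · rintro _ ⟨y, e, rfl⟩
          rw [hs, e]
        · intro y e
          exact ⟨_, ⟨y, e, rfl⟩, hs y e⟩
        · rintro _ ⟨y, e, rfl⟩ _ ⟨y', e', rfl⟩ h1
          rw [hs, hs] at h1
          subst h1
          rfl
      obtain ⟨b, rfl, H⟩ := D.ex _ _ hS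
      refine ⟨b, Sec.ext' rfl fun y h1 h2 => ?_⟩
      obtain ⟨y', e, h3⟩ := H (t y b h1) (ht2 y b h1)
      have h4 : y' = y := by rw [← hs y' e, ← h3]; exact ht1 y b h1
      subst h4
      exact h3
  have hα : Function.Bijective α := by
    constructor
    · intro a a' e
      exact D.pb.inj _ _ (congrArg (fun q => q.1.1) e) (hβ.1 (congrArg (fun q => q.1.2) e))
    · rintro ⟨⟨y, σ⟩, e⟩
      obtain ⟨b, rfl⟩ := hβ.2 σ
      refine ⟨t y b e, Subtype.ext (Prod.ext (ht1 y b e) (congrArg β (ht2 y b e)))⟩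
  have hβe : IsEquivariant G β := by
    intro a b
    refine Sec.ext' (MulActionHom.map_smul h a b) fun y h1 h2 => ?_
    have h3 : j (a⁻¹ • y) = h b := by
      rw [MulActionHom.map_smul, h2]
      exact inv_smul_smul _ _
    refine Eq.trans ?_ (Sec.smul_sec a (β b) y h2 h3).symm
    show f (t y (a • b) h1) = a • f (t (a⁻¹ • y) b h3)
    rw [← MulActionHom.map_smul]
    refine congrArg f (D.pb.inj _ _ ?_ ?_)
    · rw [MulActionHom.map_smul, MulActionHom.map_smul, ht1, ht1, smul_inv_smul]
    · rw [MulActionHom.map_smul, ht2, ht2]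
  refine ⟨Equiv.ofBijective α hα, Equiv.ofBijective β hβ, ?_, hβe, fun a => hsec a _,
    fun _ => rfl, fun _ => rfl⟩
  intro a x
  refine Subtype.ext (Prod.ext ?_ ?_)
  · exact (congrArg i (MulActionHom.map_smul f a x)).trans (MulActionHom.map_smul i a (f x))
  · exact (congrArg β (MulActionHom.map_smul g a x)).trans (hβe a (g x))

theorem isDistributor_canonical (i : X →[G] Y) (j : Y →[G] Z) :
    IsDistributor i j (evalHom i j) (pi2Hom i j) (pHom i j) :=
  ⟨Equiv.refl _, Equiv.refl _, fun _ _ => rfl, fun _ _ => rfl, fun _ => rfl, fun _ => rfl,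
    fun _ => rfl⟩

/-- Exponential diagrams are unique up to isomorphism. -/
theorem Dist.exists_iso {A' B' : Type} [MulAction G A'] [MulAction G B'] {i : X →[G] Y}
    {j : Y →[G] Z} {f : A →[G] X} {g : A →[G] B} {h : B →[G] Z} {f' : A' →[G] X}
    {g' : A' →[G] B'} {h' : B' →[G] Z} (D : Dist i j f g h) (D' : Dist i j f' g' h') :
    ∃ (γ : A' →[G] A) (β : B' →[G] B), Function.Bijective γ ∧ Function.Bijective β ∧
      (∀ a, f (γ a) = f' a) ∧ (∀ a, g (γ a) = β (g' a)) ∧ ∀ b, h (β b) = h' b := by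
  obtain ⟨α1, β1, hα1, hβ1, hf1, hg1, hh1⟩ := D.isDistributor
  obtain ⟨α2, β2, hα2, hβ2, hf2, hg2, hh2⟩ := D'.isDistributor
  refine ⟨⟨α2.trans α1.symm, fun a x => ?_⟩, ⟨β2.trans β1.symm, fun a x => ?_⟩,
    (α2.trans α1.symm).bijective, (β2.trans β1.symm).bijective, fun a => ?_, fun a => ?_,
    fun b => ?_⟩
  · apply α1.injective
    simp [hα1 _ _, hα2 _ _]
  · apply β1.injective
    simp [hβ1 _ _, hβ2 _ _]
  · show f (α1.symm (α2 a)) = _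
    rw [← hf1, ← hf2, Equiv.apply_symm_apply]
  · show g (α1.symm (α2 a)) = β1.symm (β2 (g' a))
    apply β1.injective
    rw [hg1, hg2, Equiv.apply_symm_apply, Equiv.apply_symm_apply]
  · show h (β1.symm (β2 b)) = _
    rw [← hh1, ← hh2, Equiv.apply_symm_apply]

theorem Pb.sq (f : X →[G] Z) (g : Y →[G] Z) : PbSq (Pb.fstHom f g) (Pb.sndHom f g) f g :=
  ⟨fun w => w.2, fun x y e => ⟨⟨(x, y), e⟩, rfl, rfl⟩,
    fun _ _ h1 h2 => Subtype.ext (Prod.ext h1 h2)⟩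

/-- Equivariant maps into a pullback. -/
theorem PbSq.exists_lift {p : P →[G] X} {q : P →[G] Y} {f : X →[G] Z} {g : Y →[G] Z}
    (h : PbSq p q f g) (a : A →[G] X) (b : A →[G] Y) (e : ∀ t, f (a t) = g (b t)) :
    ∃ c : A →[G] P, (∀ t, p (c t) = a t) ∧ ∀ t, q (c t) = b t := by
  choose c h1 h2 using fun t => h.ex (a t) (b t) (e t)
  refine ⟨⟨c, fun s t => h.inj _ _ ?_ ?_⟩, h1, h2⟩
  · show p (c (s • t)) = p (s • c t)
    rw [h1, MulActionHom.map_smul, MulActionHom.map_smul, h1]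
  · show q (c (s • t)) = q (s • c t)
    rw [h2, MulActionHom.map_smul, MulActionHom.map_smul, h2]

theorem exists_inverse {f : X →[G] Y} (hf : Function.Bijective f) :
    ∃ g : Y →[G] X, (∀ x, g (f x) = x) ∧ ∀ y, f (g y) = y := by
  choose g hg using hf.2
  refine ⟨⟨g, fun s t => hf.1 ?_⟩, fun x => hf.1 (hg _), hg⟩
  show f (g (s • t)) = f (s • g t)
  rw [hg, MulActionHom.map_smul, hg]

end Equivariant

theorem exists_pbSq {X Y Z : FinGSet G} (f : X.carrier →[G] Z.carrier)
    (g : Y.carrier →[G] Z.carrier) :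
    ∃ (P : FinGSet G) (p : P.carrier →[G] X.carrier) (q : P.carrier →[G] Y.carrier),
      PbSq p q f g :=
  ⟨mkG G (Pb f g), Pb.fstHom f g, Pb.sndHom f g, Pb.sq f g⟩

theorem exists_dist {X Y Z : FinGSet G} (i : X.carrier →[G] Y.carrier)
    (j : Y.carrier →[G] Z.carrier) :
    ∃ (A B : FinGSet G) (f : A.carrier →[G] X.carrier) (g : A.carrier →[G] B.carrier)
      (h : B.carrier →[G] Z.carrier), Dist i j f g h :=
  ⟨mkG G (ECan i j), mkG G (Sec i j), evalHom i j, pi2Hom i j, pHom i j,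
    (isDistributor_canonical i j).dist⟩

/-- The finite `G`-set of pairs satisfying an invariant relation. -/
def relG {Z : FinGSet G} (r : Z.carrier × Z.carrier → Prop)
    (hr : ∀ (a : G) p, r p → r (a • p)) : FinGSet G :=
  @FinGSet.mk G _ {p // r p} Subtype.finite
    { smul := fun a p => ⟨(a • p.1.1, a • p.1.2), hr a p.1 p.2⟩
      one_smul := fun _ => Subtype.ext (Prod.ext (one_smul _ _) (one_smul _ _))
      mul_smul := fun _ _ _ => Subtype.ext (Prod.ext (mul_smul _ _ _) (mul_smul _ _ _)) }

namespace SemiMackey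

variable (M : SemiMackey G)

theorem res_tr_of_bijective {Z Z' : FinGSet G} {c : Z.carrier →[G] Z'.carrier}
    (hc : Function.Bijective c) (y : M.obj Z) : M.res c (M.tr c y) = y := by
  have key : ∀ (r r' : Z.carrier × Z.carrier → Prop) (hr : ∀ (a : G) p, r p → r (a • p))
      (hr' : ∀ (a : G) p, r' p → r' (a • p)), r = r' →
      M.tr (X := relG r hr) (Y := Z) ⟨fun p => p.1.1, fun _ _ => rfl⟩
        (M.res (X := relG r hr) (Y := Z) ⟨fun p => p.1.2, fun _ _ => rfl⟩ y) =
      M.tr (X := relG r' hr') (Y := Z) ⟨fun p => p.1.1, fun _ _ => rfl⟩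
        (M.res (X := relG r' hr') (Y := Z) ⟨fun p => p.1.2, fun _ _ => rfl⟩ y) := by
    rintro r _ hr hr' rfl
    rfl
  have inv : ∀ {T : FinGSet G} (d : Z.carrier →[G] T.carrier) (a : G) (p : Z.carrier × Z.carrier),
      d p.1 = d p.2 → d (a • p).1 = d (a • p).2 := fun d a p h => by
    show d (a • p.1) = d (a • p.2)
    rw [MulActionHom.map_smul, MulActionHom.map_smul, h]
  have h1 := M.mackey c c y
  have h2 := M.mackey (gid G Z.carrier) (gid G Z.carrier) y
  rw [M.tr_id, M.res_id] at h2
  rw [h1]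
  refine Eq.trans ?_ h2.symm
  exact key (fun p => c p.1 = c p.2) (fun p => gid G Z.carrier p.1 = gid G Z.carrier p.2)
    (inv c) (inv (gid G Z.carrier)) (funext fun p => propext hc.1.eq_iff)

end SemiMackey

namespace SemiMackey

variable (M : SemiMackey G) {X Y Z P : FinGSet G}

theorem res_res {i : X.carrier →[G] Y.carrier} {j : Y.carrier →[G] Z.carrier}
    {k : X.carrier →[G] Z.carrier} (e : ∀ x, j (i x) = k x) (z : M.obj Z) :
    M.res i (M.res j z) = M.res k z := by
  rw [M.res_comp, show gcomp j i = k from MulActionHom.ext e]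

theorem tr_tr {i : X.carrier →[G] Y.carrier} {j : Y.carrier →[G] Z.carrier}
    {k : X.carrier →[G] Z.carrier} (e : ∀ x, j (i x) = k x) (x : M.obj X) :
    M.tr j (M.tr i x) = M.tr k x := by
  rw [M.tr_comp, show gcomp j i = k from MulActionHom.ext e]

theorem res_bijective {c : X.carrier →[G] Y.carrier} (hc : Function.Bijective c) :
    Function.Bijective (M.res c) := by
  obtain ⟨d, h1, h2⟩ := exists_inverse hc
  refine Function.bijective_iff_has_inverse.2 ⟨M.res d, fun y => ?_, fun x => ?_⟩
  · rw [M.res_res (k := gid G _) h2, M.res_id]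
  · rw [M.res_res (k := gid G _) h1, M.res_id]

theorem tr_res_of_bijective {c : X.carrier →[G] Y.carrier} (hc : Function.Bijective c)
    (y : M.obj Y) : M.tr c (M.res c y) = y :=
  (M.res_bijective hc).1 (M.res_tr_of_bijective hc _)

theorem mackey_sq {p : P.carrier →[G] X.carrier} {q : P.carrier →[G] Y.carrier}
    {j : X.carrier →[G] Z.carrier} {i : Y.carrier →[G] Z.carrier} (h : PbSq p q j i)
    (y : M.obj Y) : M.res j (M.tr i y) = M.tr p (M.res q y) := by
  obtain ⟨c, h1, h2⟩ := (Pb.sq j i).exists_lift p q h.comm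
  have hc : Function.Bijective c := (Pb.sq j i).bijective h h1 h2
  rw [M.mackey, ← M.res_res (Y := mkG G (Pb j i)) h2, ← M.tr_tr (Y := mkG G (Pb j i)) h1,
    M.tr_res_of_bijective (Y := mkG G (Pb j i)) hc]

theorem subsingleton_of_isEmpty [IsEmpty X.carrier] : Subsingleton (M.obj X) := by
  have hc : Function.Bijective (initHom X) :=
    ⟨fun a => a.elim, fun x => isEmptyElim x⟩
  have := M.empty_subsingleton
  exact (M.res_bijective hc).1.subsingleton

theorem sum_ext {z z' : M.obj (sumG X Y)} (h1 : M.res (inlHom X Y) z = M.res (inlHom X Y) z')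
    (h2 : M.res (inrHom X Y) z = M.res (inrHom X Y) z') : z = z' :=
  (M.sum_bij X Y).1 (Prod.ext h1 h2)

theorem res_inl_pairElt (x : M.obj X) (y : M.obj Y) :
    M.res (inlHom X Y) (M.pairElt x y) = x :=
  congrArg Prod.fst ((Equiv.ofBijective _ (M.sum_bij X Y)).apply_symm_apply (x, y))

theorem res_inr_pairElt (x : M.obj X) (y : M.obj Y) :
    M.res (inrHom X Y) (M.pairElt x y) = y :=
  congrArg Prod.snd ((Equiv.ofBijective _ (M.sum_bij X Y)).apply_symm_apply (x, y))

theorem res_sumMap_pairElt {X' Y' : FinGSet G} (f : X'.carrier →[G] X.carrier)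
    (g : Y'.carrier →[G] Y.carrier) (x : M.obj X) (y : M.obj Y) :
    M.res (sumMapHom f g) (M.pairElt x y) = M.pairElt (M.res f x) (M.res g y) := by
  apply M.sum_ext
  · rw [M.res_inl_pairElt, M.res_comp]
    conv_rhs => rw [← M.res_inl_pairElt x y, M.res_comp]
    rfl
  · rw [M.res_inr_pairElt, M.res_comp]
    conv_rhs => rw [← M.res_inr_pairElt x y, M.res_comp]
    rfl

theorem tr_sumMap_pairElt {X' Y' : FinGSet G} (f : X.carrier →[G] X'.carrier)
    (g : Y.carrier →[G] Y'.carrier) (x : M.obj X) (y : M.obj Y) :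
    M.tr (sumMapHom f g) (M.pairElt x y) = M.pairElt (M.tr f x) (M.tr g y) := by
  apply M.sum_ext
  · rw [M.res_inl_pairElt, M.mackey_sq (p := f) (q := inlHom X Y) (PbSq.inl _ _),
      M.res_inl_pairElt]
  · rw [M.res_inr_pairElt, M.mackey_sq (p := g) (q := inrHom X Y) (PbSq.inr _ _),
      M.res_inr_pairElt]

end SemiMackey

namespace SemiTambara

variable (R : SemiTambara G) {X Y Z P A B : FinGSet G}

theorem nm_nm {i : X.carrier →[G] Y.carrier} {j : Y.carrier →[G] Z.carrier}
    {k : X.carrier →[G] Z.carrier} (e : ∀ x, j (i x) = k x) (x : R.obj X) :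
    R.nm j (R.nm i x) = R.nm k x := by
  rw [R.nm_comp, show gcomp j i = k from MulActionHom.ext e]

theorem distrib_dist {i : X.carrier →[G] Y.carrier} {j : Y.carrier →[G] Z.carrier}
    {f : A.carrier →[G] X.carrier} {g : A.carrier →[G] B.carrier} {h : B.carrier →[G] Z.carrier}
    (D : Dist i j f g h) (x : R.obj X) : R.nm j (R.tr i x) = R.tr h (R.nm g (R.res f x)) :=
  R.distrib i j f g h D.isDistributor x

theorem nm_res_of_bijective {c : X.carrier →[G] Y.carrier} (hc : Function.Bijective c)
    (y : R.obj Y) : R.nm c (R.res c y) = y := by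
  have h := R.distrib_dist (i := gid G _) (j := gid G _) (f := c) (g := c) (h := gid G _)
    (Dist.idMid hc) y
  rw [R.tr_id, R.tr_id, R.nm_id] at h
  exact h.symm

theorem nm_res_sq {p : P.carrier →[G] X.carrier} {q : P.carrier →[G] Y.carrier}
    {j : X.carrier →[G] Z.carrier} {i : Y.carrier →[G] Z.carrier} (h : PbSq p q j i)
    (y : R.obj Y) : R.res j (R.nm i y) = R.nm p (R.res q y) := by
  obtain ⟨c, h1, h2⟩ := (Pb.sq j i).exists_lift p q h.comm
  have hc : Function.Bijective c := (Pb.sq j i).bijective h h1 h2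
  rw [R.nm_res, ← R.res_res (Y := mkG G (Pb j i)) h2, ← R.nm_nm (Y := mkG G (Pb j i)) h1,
    R.nm_res_of_bijective (Y := mkG G (Pb j i)) hc]

end SemiTambara

namespace sT

variable {M : SemiMackey G} {X Y Z U V U' V' : FinGSet G}

/-- The class of a pair `(U →i V →j X, u)` in `sT(M)(X)`. -/
def mk (M : SemiMackey G) {X U V : FinGSet G} (i : U.carrier →[G] V.carrier)
    (j : V.carrier →[G] X.carrier) (u : M.obj U) : sT M X :=
  Quot.mk (STRel M X) ⟨U, V, i, j, u⟩

theorem ind {p : sT M X → Prop} (h : ∀ (U V : FinGSet G) (i : U.carrier →[G] V.carrier)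
    (j : V.carrier →[G] X.carrier) (u : M.obj U), p (mk M i j u)) (x : sT M X) : p x :=
  Quot.ind (fun a => h a.U a.V a.i a.j a.u) x

/-- An isomorphism of pairs is an instance of the distributive law, so a relation holds between
related pairs as soon as it holds for the distributive law. -/
theorem rel_ind {p : PreT M X → PreT M X → Prop}
    (h : ∀ (W U V A B : FinGSet G) (k : W.carrier →[G] U.carrier) (i : U.carrier →[G] V.carrier)
      (j : V.carrier →[G] X.carrier) (f : A.carrier →[G] W.carrier) (g : A.carrier →[G] B.carrier)
      (h : B.carrier →[G] V.carrier), Dist k i f g h → ∀ w : M.obj W,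
      p ⟨U, V, i, j, M.tr k w⟩ ⟨A, B, g, gcomp j h, M.res f w⟩) {a b : PreT M X}
    (r : STRel M X a b) : p a b := by
  cases r with
  | distrib k i j f g h' D w => exact h _ _ _ _ _ k i j f g h' D.dist w
  | iso r =>
    obtain ⟨U, V, i, j, u⟩ := a
    obtain ⟨U', V', i', j', u'⟩ := b
    obtain ⟨f, g, hf, hg, h1, h2, h3⟩ := r
    dsimp only at f g h1 h2 h3
    have := h U U V U' V' (gid G _) i j ⟨f, hf⟩ i' ⟨g, hg⟩
      (Dist.idLeft f.bijective g.bijective h1) u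
    rwa [M.tr_id, show gcomp j ⟨g, hg⟩ = j' from MulActionHom.ext h2, h3] at this

theorem sound {W A B : FinGSet G} {k : W.carrier →[G] U.carrier} {i : U.carrier →[G] V.carrier}
    {j : V.carrier →[G] X.carrier} {f : A.carrier →[G] W.carrier} {g : A.carrier →[G] B.carrier}
    {h : B.carrier →[G] V.carrier} (D : Dist k i f g h) {j' : B.carrier →[G] X.carrier}
    (e : ∀ b, j (h b) = j' b) (w : M.obj W) :
    mk M i j (M.tr k w) = mk M g j' (M.res f w) := by
  rw [← show gcomp j h = j' from MulActionHom.ext e]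
  exact Quot.sound (STRel.distrib k i j f g h D.isDistributor w)

theorem mk_eq_of_iso {i : U.carrier →[G] V.carrier} {j : V.carrier →[G] X.carrier}
    {i' : U'.carrier →[G] V'.carrier} {j' : V'.carrier →[G] X.carrier}
    {f : U'.carrier →[G] U.carrier} {g : V'.carrier →[G] V.carrier} (hf : Function.Bijective f)
    (hg : Function.Bijective g) (h1 : ∀ x, i (f x) = g (i' x)) (h2 : ∀ x, j (g x) = j' x)
    {u : M.obj U} {u' : M.obj U'} (hu : M.res f u = u') : mk M i j u = mk M i' j' u' := by
  have := sound (M := M) (k := gid G _) (Dist.idLeft (f := f) (h := g) hf hg h1) h2 u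
  rwa [M.tr_id, hu] at this

/-- The restriction of a pair may be computed from any choice of pullbacks. -/
theorem mk_resPre {φ : Y.carrier →[G] X.carrier} {i : U.carrier →[G] V.carrier}
    {j : V.carrier →[G] X.carrier} {u : M.obj U} {v : V'.carrier →[G] V.carrier}
    {j' : V'.carrier →[G] Y.carrier} {p : U'.carrier →[G] U.carrier}
    {i' : U'.carrier →[G] V'.carrier} (h1 : PbSq v j' j φ) (h2 : PbSq p i' i v) {u' : M.obj U'}
    (hu : M.res p u = u') :
    Quot.mk (STRel M Y) (resPre M φ ⟨U, V, i, j, u⟩) = mk M i' j' u' := by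
  obtain ⟨c, c1, c2⟩ := (Pb.sq j φ).exists_lift v j' h1.comm
  have hc : Function.Bijective c := (Pb.sq j φ).bijective h1 c1 c2
  have h3 := h2.compBij hc c1
  have h4 := Pb.sq i (Pb.fstHom j φ)
  obtain ⟨d, d1, d2⟩ := h4.exists_lift p (gcomp (Z := Pb j φ) c i') h3.comm
  have hd : Function.Bijective d := h4.bijective h3 d1 d2
  refine mk_eq_of_iso (V := mkG G (Pb j φ)) (U := mkG G (Pb i (Pb.fstHom j φ))) hd hc d2 c2 ?_
  exact (M.res_res (Y := mkG G (Pb i (Pb.fstHom j φ))) d1 u).trans hu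

/-- The norm of a pair may be computed from any choice of exponential diagram and pullback. -/
theorem mk_normPre {A P B : FinGSet G} {φ : X.carrier →[G] Y.carrier}
    {i : U.carrier →[G] V.carrier} {j : V.carrier →[G] X.carrier} {u : M.obj U}
    {a : A.carrier →[G] V.carrier} {h : A.carrier →[G] B.carrier} {k : B.carrier →[G] Y.carrier}
    {p : P.carrier →[G] U.carrier} {q : P.carrier →[G] A.carrier} (D : Dist j φ a h k)
    (h2 : PbSq p q i a) {i' : P.carrier →[G] B.carrier} (hi : ∀ x, h (q x) = i' x)
    {u' : M.obj P} (hu : M.res p u = u') :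
    Quot.mk (STRel M Y) (normPre M φ ⟨U, V, i, j, u⟩) = mk M i' k u' := by
  obtain ⟨γ, β, hγ, hβ, e1, e2, e3⟩ := (isDistributor_canonical j φ).dist.exists_iso D
  have h3 := h2.compBij hγ e1
  have h4 := Pb.sq i (evalHom j φ)
  obtain ⟨d, d1, d2⟩ := h4.exists_lift p (gcomp (Z := ECan j φ) γ q) h3.comm
  have hd : Function.Bijective d := h4.bijective h3 d1 d2
  refine mk_eq_of_iso (V := mkG G (Sec j φ)) (U := mkG G (Pb i (evalHom j φ))) hd hβ ?_ e3 ?_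
  · intro x
    refine (congrArg (pi2Hom j φ) (d2 x)).trans ((e2 (q x)).trans (congrArg β (hi x)))
  · exact (M.res_res (Y := mkG G (Pb i (evalHom j φ))) d1 u).trans hu

/-- Transfer on `sT(M)`. -/
def tr (φ : X.carrier →[G] Y.carrier) : sT M X → sT M Y :=
  Quot.lift (fun a => Quot.mk _ (trPre M φ a)) fun a b r => by
    refine rel_ind (p := fun a b => Quot.mk _ (trPre M φ a) = Quot.mk _ (trPre M φ b)) ?_ r
    intro W U V A B k i j f g h D w
    exact sound (j := gcomp φ j) D (fun _ => rfl) w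

theorem resPre_rel (φ : Y.carrier →[G] X.carrier) {a b : PreT M X} (r : STRel M X a b) :
    Quot.mk (STRel M Y) (resPre M φ a) = Quot.mk (STRel M Y) (resPre M φ b) := by
  refine rel_ind (p := fun a b => Quot.mk _ (resPre M φ a) = Quot.mk _ (resPre M φ b)) ?_ r
  intro W U V A B k i j f g h D w
  obtain ⟨V', v, j', hv⟩ := exists_pbSq j φ
  obtain ⟨U', u, i', hu⟩ := exists_pbSq i v
  obtain ⟨W', k', w', hw⟩ := exists_pbSq u k
  obtain ⟨B', b, h', hb⟩ := exists_pbSq h v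
  obtain ⟨A', a, g', ha⟩ := exists_pbSq g b
  obtain ⟨s, s1, s2⟩ := hu.exists_lift (gcomp k (gcomp f a)) (gcomp h' g') fun t => by
    simp only [gcomp_apply]
    rw [D.pb.comm, ha.comm, hb.comm]
  obtain ⟨f', f1, f2⟩ := hw.exists_lift s (gcomp f a) s1
  have D' : Dist k' i' f' g' h' := D.baseChange hw.symm hu hb ha f2 fun t => by
    rw [f1, s2, gcomp_apply]
  rw [mk_resPre hv hu (M.mackey_sq hw w), sound D' (j' := gcomp j' h') (fun _ => rfl),
    M.res_res f2, mk_resPre (j' := gcomp j' h') (hv.symm.paste hb.symm).symm ha (M.res_comp _ _ _)]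

theorem normPre_rel (φ : X.carrier →[G] Y.carrier) {a b : PreT M X} (r : STRel M X a b) :
    Quot.mk (STRel M Y) (normPre M φ a) = Quot.mk (STRel M Y) (normPre M φ b) := by
  refine rel_ind (p := fun a b => Quot.mk _ (normPre M φ a) = Quot.mk _ (normPre M φ b)) ?_ r
  intro W U V A B k i j f g h D w
  obtain ⟨A1, B1, a1, h1, k1, D1⟩ := exists_dist j φ
  obtain ⟨P, p, q, hp⟩ := exists_pbSq i a1
  obtain ⟨W', k', w', hw⟩ := exists_pbSq p k
  obtain ⟨B2, b2, h2, hb⟩ := exists_pbSq h a1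
  obtain ⟨A2, a2, g2, ha⟩ := exists_pbSq g b2
  obtain ⟨A3, B3, a3, h3, k3, D3⟩ := exists_dist h2 h1
  obtain ⟨P3, r, q3, hr⟩ := exists_pbSq g2 a3
  obtain ⟨s, s1, s2⟩ := hp.exists_lift (gcomp k (gcomp f a2)) (gcomp h2 g2) fun t => by
    simp only [gcomp_apply]
    rw [D.pb.comm, ha.comm, hb.comm]
  obtain ⟨f2, f21, f22⟩ := hw.exists_lift s (gcomp f a2) s1
  have D2 : Dist k' q f2 g2 h2 := D.baseChange hw.symm hp hb ha f22 fun t => by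
    rw [f21, s2, gcomp_apply]
  have D4 : Dist k' (gcomp h1 q) (gcomp f2 r) (gcomp h3 q3) k3 := D2.compRight D3 hr
  have D5 : Dist (gcomp j h) φ (gcomp b2 a3) h3 (gcomp k1 k3) := D1.compLeft hb D3
  rw [mk_normPre D1 hp (i' := gcomp h1 q) (fun _ => rfl) (M.mackey_sq hw w),
    sound D4 (j' := gcomp k1 k3) (fun _ => rfl),
    mk_normPre (p := gcomp a2 r) (q := q3) D5 (ha.paste hr)
      (i' := gcomp h3 q3) (fun _ => rfl) (M.res_comp _ _ _),
    M.res_comp]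
  congr 2
  exact MulActionHom.ext fun t => f22 (r t)

end sT

namespace sT

variable {M : SemiMackey G} {X Y Z U V U' V' : FinGSet G}

/-- Restriction on `sT(M)`. -/
def res (φ : Y.carrier →[G] X.carrier) : sT M X → sT M Y :=
  Quot.lift (fun a => Quot.mk _ (resPre M φ a)) fun _ _ r => resPre_rel φ r

/-- Norm on `sT(M)`. -/
def nm (φ : X.carrier →[G] Y.carrier) : sT M X → sT M Y :=
  Quot.lift (fun a => Quot.mk _ (normPre M φ a)) fun _ _ r => normPre_rel φ r

theorem tr_mk {φ : X.carrier →[G] Y.carrier} {i : U.carrier →[G] V.carrier}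
    {j : V.carrier →[G] X.carrier} {u : M.obj U} :
    tr φ (mk M i j u) = mk M i (gcomp φ j) u := rfl

theorem res_mk {φ : Y.carrier →[G] X.carrier} {i : U.carrier →[G] V.carrier}
    {j : V.carrier →[G] X.carrier} {u : M.obj U} {v : V'.carrier →[G] V.carrier}
    {j' : V'.carrier →[G] Y.carrier} {p : U'.carrier →[G] U.carrier}
    {i' : U'.carrier →[G] V'.carrier} (h1 : PbSq v j' j φ) (h2 : PbSq p i' i v) {u' : M.obj U'}
    (hu : M.res p u = u') : res φ (mk M i j u) = mk M i' j' u' :=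
  mk_resPre h1 h2 hu

theorem nm_mk {A P B : FinGSet G} {φ : X.carrier →[G] Y.carrier}
    {i : U.carrier →[G] V.carrier} {j : V.carrier →[G] X.carrier} {u : M.obj U}
    {a : A.carrier →[G] V.carrier} {h : A.carrier →[G] B.carrier} {k : B.carrier →[G] Y.carrier}
    {p : P.carrier →[G] U.carrier} {q : P.carrier →[G] A.carrier} (D : Dist j φ a h k)
    (h2 : PbSq p q i a) {i' : P.carrier →[G] B.carrier} (hi : ∀ x, h (q x) = i' x)
    {u' : M.obj P} (hu : M.res p u = u') : nm φ (mk M i j u) = mk M i' k u' :=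
  mk_normPre D h2 hi hu

theorem res_id (x : sT M X) : res (gid G X.carrier) x = x := by
  induction x using ind with
  | h U V i j u =>
  exact res_mk (v := gid G _) (p := gid G _) (PbSq.idRight j) (PbSq.idRight i) (M.res_id u)

theorem res_res (f : X.carrier →[G] Y.carrier) (g : Y.carrier →[G] Z.carrier) (x : sT M Z) :
    res f (res g x) = res (gcomp g f) x := by
  induction x using ind with
  | h U V i j u =>
  obtain ⟨V1, v1, j1, hv1⟩ := exists_pbSq j g
  obtain ⟨U1, u1, i1, hu1⟩ := exists_pbSq i v1
  obtain ⟨V2, v2, j2, hv2⟩ := exists_pbSq j1 f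
  obtain ⟨U2, u2, i2, hu2⟩ := exists_pbSq i1 v2
  rw [res_mk hv1 hu1 rfl, res_mk hv2 hu2 rfl,
    res_mk (φ := gcomp g f) (i := i) (j := j) (v := gcomp v1 v2) (p := gcomp u1 u2)
      (hv1.paste hv2) (hu1.paste hu2) (M.res_comp _ _ _).symm]

theorem mackey {P : FinGSet G} {s : P.carrier →[G] X.carrier} {t : P.carrier →[G] Y.carrier}
    {φ : X.carrier →[G] Z.carrier} {ψ : Y.carrier →[G] Z.carrier} (h : PbSq s t φ ψ)
    (y : sT M Y) : res φ (tr ψ y) = tr s (res t y) := by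
  induction y using ind with
  | h U V i j u =>
  obtain ⟨V', v, j', hv⟩ := exists_pbSq j t
  obtain ⟨U', p, i', hu⟩ := exists_pbSq i v
  rw [tr_mk, res_mk (φ := t) hv hu rfl, tr_mk,
    res_mk (φ := φ) (i := i) (j := gcomp ψ j) (v := v) (j' := gcomp s j')
      (h.paste hv.symm).symm hu rfl]

theorem nm_id (x : sT M X) : nm (gid G X.carrier) x = x := by
  induction x using ind with
  | h U V i j u =>
  exact nm_mk (a := gid G _) (h := gid G _) (p := gid G _) (q := i) (k := j)
    (Dist.idMid Function.bijective_id) (PbSq.idRight i) (fun _ => rfl) (M.res_id u)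

theorem nm_nm (f : X.carrier →[G] Y.carrier) (g : Y.carrier →[G] Z.carrier) (x : sT M X) :
    nm g (nm f x) = nm (gcomp g f) x := by
  induction x using ind with
  | h U V i j u =>
  obtain ⟨A, B, a, h, k, D⟩ := exists_dist j f
  obtain ⟨P, p, q, hp⟩ := exists_pbSq i a
  obtain ⟨A', B', a', h', k', D'⟩ := exists_dist k g
  obtain ⟨R, r, s, hr⟩ := exists_pbSq h a'
  obtain ⟨P', t, m, ht⟩ := exists_pbSq q r
  rw [nm_mk D hp (i' := gcomp h q) (fun _ => rfl) rfl,
    nm_mk D' (i := gcomp h q) (p := t) (q := gcomp s m) (hr.symm.paste ht.symm).symm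
      (i' := gcomp h' (gcomp s m)) (fun _ => rfl) rfl,
    nm_mk (φ := gcomp g f) (i := i) (j := j) (a := gcomp a r) (h := gcomp h' s)
      (p := gcomp p t) (D.compRight D' hr) (hp.paste ht)
      (i' := gcomp h' (gcomp s m)) (fun _ => rfl) (M.res_comp _ _ _).symm]

theorem res_nm {Q : FinGSet G} {s : Q.carrier →[G] X.carrier} {t : Q.carrier →[G] Y.carrier}
    {φ : X.carrier →[G] Z.carrier} {ψ : Y.carrier →[G] Z.carrier} (hQ : PbSq s t φ ψ)
    (y : sT M Y) : res φ (nm ψ y) = nm s (res t y) := by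
  induction y using ind with
  | h U V i j u =>
  obtain ⟨A, B, a, h, k, D⟩ := exists_dist j ψ
  obtain ⟨P, p, q, hp⟩ := exists_pbSq i a
  obtain ⟨B', b, k', hb⟩ := exists_pbSq k φ
  obtain ⟨V', v, j', hv⟩ := exists_pbSq j t
  obtain ⟨U', w, i', hw⟩ := exists_pbSq i v
  obtain ⟨A', α, h', hα⟩ := exists_pbSq h b
  obtain ⟨P', c, d, hc⟩ := exists_pbSq q α
  obtain ⟨l, l1, l2⟩ := hQ.exists_lift (gcomp k' h') (gcomp j (gcomp a α)) fun x => by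
    simp only [gcomp_apply]
    rw [D.pb.comm, hα.comm, hb.comm]
  obtain ⟨a', a1, a2⟩ := hv.exists_lift (gcomp a α) l fun x => (l2 x).symm
  obtain ⟨e, e1, e2⟩ := hw.exists_lift (gcomp p c) (gcomp a' d) fun x => by
    simp only [gcomp_apply]
    rw [hp.comm, hc.comm, a1, gcomp_apply]
  have D' : Dist j' s a' h' k' := D.baseChange hv hQ.symm hb hα a1 fun x => by
    rw [a2, l1, gcomp_apply]
  have he : PbSq e d i' a' := by
    refine hw.cancel ?_ e2
    have := hp.paste hc
    rwa [show (fun x => p (c x)) = fun x => w (e x) from funext fun x => (e1 x).symm,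
      show (fun x => a (α x)) = fun x => v (a' x) from funext fun x => (a1 x).symm] at this
  rw [nm_mk D hp (i' := gcomp h q) (fun _ => rfl) rfl,
    res_mk hb (i' := gcomp h' d) (hα.symm.paste hc.symm).symm (M.res_comp _ _ _),
    res_mk hv hw rfl, nm_mk D' he (i' := gcomp h' d) (fun _ => rfl) (M.res_res e1 u)]

theorem nm_tr {A B : FinGSet G} {i : X.carrier →[G] Y.carrier} {j : Y.carrier →[G] Z.carrier}
    {f : A.carrier →[G] X.carrier} {g : A.carrier →[G] B.carrier} {h : B.carrier →[G] Z.carrier}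
    (D : Dist i j f g h) (x : sT M X) : nm j (tr i x) = tr h (nm g (res f x)) := by
  induction x using ind with
  | h U V a b u =>
  obtain ⟨V', x, v, hx⟩ := exists_pbSq b f
  obtain ⟨A', B', f', g', h', D'⟩ := exists_dist v g
  obtain ⟨U', y, w, hy⟩ := exists_pbSq a x
  obtain ⟨P, r, q, hr⟩ := exists_pbSq w f'
  rw [res_mk hx hy rfl, nm_mk D' hr (i' := gcomp g' q) (fun _ => rfl) (M.res_comp _ _ _),
    tr_mk, tr_mk, nm_mk (a := gcomp x f') (p := gcomp y r) (k := gcomp h h')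
      (D.compLeft hx D') (hy.paste hr) (i' := gcomp g' q) (fun _ => rfl) rfl]

/-- The element of `sT(M)(X ⊔ Y)` corresponding to a pair of elements. -/
noncomputable def pair : sT M X → sT M Y → sT M (sumG X Y) :=
  Quot.lift₂ (fun a b => mk M (sumMapHom a.i b.i) (sumMapHom a.j b.j) (M.pairElt a.u b.u))
    (fun a b b' r => by
      refine rel_ind (p := fun b b' => mk M (sumMapHom a.i b.i) (sumMapHom a.j b.j)
        (M.pairElt a.u b.u) = mk M (sumMapHom a.i b'.i) (sumMapHom a.j b'.j)
        (M.pairElt a.u b'.u)) ?_ r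
      intro W U V A B k i j f g h D w
      have D1 : Dist (gid G a.U.carrier) a.i (gid G a.U.carrier) a.i (gid G a.V.carrier) :=
        Dist.idLeft Function.bijective_id Function.bijective_id fun _ => rfl
      have h1 := M.tr_sumMap_pairElt (gid G a.U.carrier) k a.u w
      have h2 := M.res_sumMap_pairElt (gid G a.U.carrier) f a.u w
      rw [M.tr_id] at h1
      rw [M.res_id] at h2
      dsimp only
      rw [← h1, ← h2]
      exact sound (h := sumMapHom (X := a.V) (X' := a.V) (gid G a.V.carrier) h) (D1.sumMap D)
        (by rintro (b | b) <;> rfl) _)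
    (fun a a' b r => by
      refine rel_ind (p := fun a a' => mk M (sumMapHom a.i b.i) (sumMapHom a.j b.j)
        (M.pairElt a.u b.u) = mk M (sumMapHom a'.i b.i) (sumMapHom a'.j b.j)
        (M.pairElt a'.u b.u)) ?_ r
      intro W U V A B k i j f g h D w
      have D1 : Dist (gid G b.U.carrier) b.i (gid G b.U.carrier) b.i (gid G b.V.carrier) :=
        Dist.idLeft Function.bijective_id Function.bijective_id fun _ => rfl
      have h1 := M.tr_sumMap_pairElt k (gid G b.U.carrier) w b.u
      have h2 := M.res_sumMap_pairElt f (gid G b.U.carrier) w b.u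
      rw [M.tr_id] at h1
      rw [M.res_id] at h2
      dsimp only
      rw [← h1, ← h2]
      exact sound (h := sumMapHom (Y := b.V) (Y' := b.V) h (gid G b.V.carrier)) (D.sumMap D1)
        (by rintro (b | b) <;> rfl) _)

theorem pair_mk {i : U.carrier →[G] V.carrier} {j : V.carrier →[G] X.carrier} {u : M.obj U}
    {i' : U'.carrier →[G] V'.carrier} {j' : V'.carrier →[G] Y.carrier} {u' : M.obj U'} :
    pair (mk M i j u) (mk M i' j' u') =
      mk M (sumMapHom i i') (sumMapHom j j') (M.pairElt u u') := rfl

theorem res_inl_pair (x : sT M X) (y : sT M Y) : res (inlHom X Y) (pair x y) = x := by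
  induction x using ind with
  | h U V i j u =>
  induction y using ind with
  | h U' V' i' j' u' =>
  rw [pair_mk]
  exact res_mk (φ := inlHom X Y) (i := sumMapHom i i') (j := sumMapHom j j')
    (v := inlHom V V') (p := inlHom U U') (PbSq.inl j j').symm (PbSq.inl i i').symm
    (M.res_inl_pairElt u u')

theorem res_inr_pair (x : sT M X) (y : sT M Y) : res (inrHom X Y) (pair x y) = y := by
  induction x using ind with
  | h U V i j u =>
  induction y using ind with
  | h U' V' i' j' u' =>
  rw [pair_mk]
  exact res_mk (φ := inrHom X Y) (i := sumMapHom i i') (j := sumMapHom j j')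
    (v := inrHom V V') (p := inrHom U U') (PbSq.inr j j').symm (PbSq.inr i i').symm
    (M.res_inr_pairElt u u')

theorem pair_res (z : sT M (sumG X Y)) :
    pair (res (inlHom X Y) z) (res (inrHom X Y) z) = z := by
  induction z using ind with
  | h U V i j u =>
  obtain ⟨V1, v1, j1, hv1⟩ := exists_pbSq j (inlHom X Y)
  obtain ⟨U1, u1, i1, hu1⟩ := exists_pbSq i v1
  obtain ⟨V2, v2, j2, hv2⟩ := exists_pbSq j (inrHom X Y)
  obtain ⟨U2, u2, i2, hu2⟩ := exists_pbSq i v2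
  rw [res_mk hv1 hu1 rfl, res_mk hv2 hu2 rfl, pair_mk]
  refine (mk_eq_of_iso (f := sumElimHom u1 u2) (g := sumElimHom v1 v2) ?_
    (hv1.sumElim_bijective hv2) ?_ ?_ ?_).symm
  · exact (hv1.symm.paste hu1.symm).symm.sumElim_bijective (hv2.symm.paste hu2.symm).symm
  · rintro (x | x)
    · exact hu1.comm x
    · exact hu2.comm x
  · rintro (x | x)
    · exact hv1.comm x
    · exact hv2.comm x
  · apply M.sum_ext
    · rw [M.res_inl_pairElt]
      exact M.res_res (fun _ => rfl) u
    · rw [M.res_inr_pairElt]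
      exact M.res_res (fun _ => rfl) u

theorem subsingleton_empty (M : SemiMackey G) : Subsingleton (sT M (emptyG G)) := by
  refine ⟨fun x y => ?_⟩
  induction x using ind with
  | h U V i j u =>
  induction y using ind with
  | h U' V' i' j' u' =>
  have hV : IsEmpty V.carrier := ⟨fun v => (j v).elim⟩
  have hU : IsEmpty U.carrier := ⟨fun v => (j (i v)).elim⟩
  have hV' : IsEmpty V'.carrier := ⟨fun v => (j' v).elim⟩
  have hU' : IsEmpty U'.carrier := ⟨fun v => (j' (i' v)).elim⟩
  have := M.subsingleton_of_isEmpty (X := U')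
  exact mk_eq_of_iso (f := ⟨isEmptyElim, fun _ x => isEmptyElim x⟩)
    (g := ⟨isEmptyElim, fun _ x => isEmptyElim x⟩)
    ⟨fun x => isEmptyElim x, fun x => isEmptyElim x⟩
    ⟨fun x => isEmptyElim x, fun x => isEmptyElim x⟩
    (fun x => isEmptyElim x) (fun x => isEmptyElim x) (Subsingleton.elim _ _)

/-- `sT(M)` as a semi-Tambara functor. -/
def semiTambara (M : SemiMackey G) : SemiTambara G where
  obj := sT M
  nonempty X := (M.nonempty X).map fun x => Quot.mk _ (thetaPre M X x)
  res := res
  tr := tr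
  res_id := res_id
  res_comp := res_res
  tr_id x := by
    induction x using ind
    rfl
  tr_comp i j x := by
    induction x using ind
    rfl
  mackey j i y := mackey (P := mkG G (Pb j i)) (Pb.sq j i) y
  sum_bij X Y := by
    refine Function.bijective_iff_has_inverse.2 ⟨fun p => pair p.1 p.2, pair_res, fun p => ?_⟩
    exact Prod.ext (res_inl_pair _ _) (res_inr_pair _ _)
  empty_subsingleton := subsingleton_empty M
  nm := nm
  nm_id := nm_id
  nm_comp := nm_nm
  nm_res j i y := res_nm (Q := mkG G (Pb j i)) (Pb.sq j i) y
  distrib _ _ _ _ _ D x := nm_tr D.dist x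

theorem tr_nm_theta (i : U.carrier →[G] V.carrier) (j : V.carrier →[G] X.carrier) (u : M.obj U) :
    tr j (nm i (Quot.mk _ (thetaPre M U u))) = mk M i j u := by
  have h : nm i (mk M (gid G _) (gid G _) u) = mk M i (gid G _) u :=
    nm_mk (a := gid G _) (h := i) (k := gid G _) (p := gid G _) (q := gid G _)
      (Dist.idLeft (f := gid G U.carrier) (i := i) (g := i) (h := gid G V.carrier)
        Function.bijective_id Function.bijective_id fun _ => rfl)
      (PbSq.idRight _) (fun _ => rfl) (M.res_id u)
  exact (congrArg (tr j) h).trans rfl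

/-- The extension of a map of semi-Mackey functors `M → R` to `sT(M)`, levelwise. -/
def extend (R : SemiTambara G) (φ : SMackHom M R.toSemiMackey) (X : FinGSet G) :
    sT M X → R.obj X :=
  Quot.lift (fun a => R.tr a.j (R.nm a.i (φ.app _ a.u))) fun a b r => by
    refine rel_ind (p := fun a b => R.tr a.j (R.nm a.i (φ.app _ a.u)) =
      R.tr b.j (R.nm b.i (φ.app _ b.u))) ?_ r
    intro W U V A B k i j f g h D w
    dsimp only
    rw [φ.app_tr, R.distrib_dist D, R.tr_comp, φ.app_res]

theorem extend_mk (R : SemiTambara G) (φ : SMackHom M R.toSemiMackey)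
    (i : U.carrier →[G] V.carrier) (j : V.carrier →[G] X.carrier) (u : M.obj U) :
    extend R φ X (mk M i j u) = R.tr j (R.nm i (φ.app U u)) := rfl

/-- The map of semi-Tambara functors `sT(M) → R` induced by a map of semi-Mackey functors
`M → R`. -/
def extendHom (R : SemiTambara G) (φ : SMackHom M R.toSemiMackey) :
    STambHom (semiTambara M) R where
  app := extend R φ
  app_res f x := by
    induction x using ind with
    | h U V i j u =>
    obtain ⟨V', v, j', hv⟩ := exists_pbSq j f
    obtain ⟨U', p, i', hu⟩ := exists_pbSq i v
    refine (congrArg (extend R φ _) (res_mk hv hu rfl)).trans ?_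
    rw [extend_mk, extend_mk, R.mackey_sq hv.symm, R.nm_res_sq hu.symm, φ.app_res]
  app_tr f x := by
    induction x using ind with
    | h U V i j u => exact (R.tr_comp _ _ _).symm
  app_nm f x := by
    induction x using ind with
    | h U V i j u =>
    obtain ⟨A, B, a, h, k, D⟩ := exists_dist j f
    obtain ⟨P, p, q, hp⟩ := exists_pbSq i a
    refine (congrArg (extend R φ _) (nm_mk D hp (i' := gcomp h q) (fun _ => rfl) rfl)).trans ?_
    rw [extend_mk, extend_mk, R.distrib_dist D, R.nm_res_sq hp.symm, R.nm_comp, φ.app_res]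

theorem extend_theta (R : SemiTambara G) (φ : SMackHom M R.toSemiMackey) (x : M.obj X) :
    extend R φ X (Quot.mk _ (thetaPre M X x)) = φ.app X x := by
  refine (extend_mk R φ _ _ x).trans ?_
  rw [R.nm_id, R.tr_id]

theorem hom_eq_extendHom {R : SemiTambara G} {φ : SMackHom M R.toSemiMackey}
    (F : STambHom (semiTambara M) R)
    (hF : ∀ (X : FinGSet G) (x : M.obj X), F.app X (Quot.mk _ (thetaPre M X x)) = φ.app X x) :
    F = extendHom R φ := by
  have key : F.app = (extendHom R φ).app := by
    funext X x
    induction x using ind with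
    | h U V i j u =>
    let x : sT M U := Quot.mk (STRel M U) (thetaPre M U u)
    have h1 : F.app X (tr j (nm i x)) = R.tr j (F.app V (nm i x)) := F.app_tr j (nm i x)
    have h2 : F.app V (nm i x) = R.nm i (F.app U x) := F.app_nm i x
    rw [h2, hF] at h1
    exact (congrArg (F.app X) (tr_nm_theta i j u)).symm.trans h1
  obtain ⟨⟨F, h1, h2⟩, h3⟩ := F
  dsimp only at key
  subst key
  rfl

end sT

namespace Tamb

variable {G : Type} [Group G]

/-- `sT(M)`, with its descended restrictions, transfers and norms, is a
semi-Tambara functor, and together with `θ_M` it is the free semi-Tambara functor on `M`: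
every map of semi-Mackey functors `M → R` to a semi-Tambara functor `R` factors uniquely
through `θ_M` via a map of semi-Tambara functors. -/
theorem statement5 [Finite G] (M : SemiMackey G) :
    ∃ (ST : SemiTambara G) (e : ∀ X : FinGSet G, ST.obj X ≃ sT M X),
      (∀ {X Y : FinGSet G} (f : Y.carrier →[G] X.carrier) (a : PreT M X),
        ST.res f ((e X).symm (Quot.mk (STRel M X) a)) =
          (e Y).symm (Quot.mk (STRel M Y) (resPre M f a))) ∧
      (∀ {X Y : FinGSet G} (f : X.carrier →[G] Y.carrier) (a : PreT M X),
        ST.tr f ((e X).symm (Quot.mk (STRel M X) a)) =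
          (e Y).symm (Quot.mk (STRel M Y) (trPre M f a))) ∧
      (∀ {X Y : FinGSet G} (f : X.carrier →[G] Y.carrier) (a : PreT M X),
        ST.nm f ((e X).symm (Quot.mk (STRel M X) a)) =
          (e Y).symm (Quot.mk (STRel M Y) (normPre M f a))) ∧
      (∀ (R : SemiTambara G) (φ : SMackHom M R.toSemiMackey),
        ∃! F : STambHom ST R,
          ∀ (X : FinGSet G) (x : M.obj X),
            F.app X ((e X).symm (Quot.mk (STRel M X) (thetaPre M X x))) = φ.app X x) := by
  refine ⟨sT.semiTambara M, fun X => Equiv.refl _, fun _ _ => rfl, fun _ _ => rfl,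
    fun _ _ => rfl, fun R φ => ⟨sT.extendHom R φ, fun X x => sT.extend_theta R φ x, ?_⟩⟩
  exact fun F hF => sT.hom_eq_extendHom F hF

end Tamb
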